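/- Fix, for each w in the symmetric group S_n, a reduced expression w = s_{i_1}···s_{i_r}, and let S = { τ_{i_1, s_{i_2}···s_{i_r}(ν)} τ_{i_2, s_{i_3}···s_{i_r}(ν)} ··· τ_{i_r, ν} · x_{1,ν}^{a_1}···x_{n,ν}^{a_n} : w ∈ S_n, (a_1,…,a_n) ∈ Z_{≥0}^n, ν ∈ I^n } ⊆ H_n(Q). Then S generates H_n(Q) as a k-module, and for n ≥ 2 the following are equivalent: (i) H_n(Q) is a free k-module with basis S; (ii) Q is hermitian, i.e. Q_{ij}(u,v) = Q_{ji}(v,u) for all i,j ∈ I. -/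

import Mathlib

open scoped BigOperators

namespace Rouq

variable {k : Type} [CommRing k] {I : Type} {n : ℕ}

/-- Generators of the algebra `H_n(Q)`: idempotents `1_ν`, polynomial generators
`x_{a,ν}` and intertwiners `τ_{i,ν}` (in 0-based indexing). -/
inductive Gen (I : Type) (n : ℕ) : Type
  | unit (ν : Fin n → I) : Gen I n
  | x (a : Fin n) (ν : Fin n → I) : Gen I n
  | tau (i : ℕ) (h : i + 1 < n) (ν : Fin n → I) : Gen I n

/-- The free (unital) algebra on the generators. -/
abbrev FA (k : Type) [CommRing k] (I : Type) (n : ℕ) := FreeAlgebra k (Gen I n)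

def E (k : Type) [CommRing k] (ν : Fin n → I) : FA k I n :=
  FreeAlgebra.ι k (Gen.unit ν)

def Xg (k : Type) [CommRing k] (a : Fin n) (ν : Fin n → I) : FA k I n :=
  FreeAlgebra.ι k (Gen.x a ν)

def Tg (k : Type) [CommRing k] (i : ℕ) (h : i + 1 < n) (ν : Fin n → I) : FA k I n :=
  FreeAlgebra.ι k (Gen.tau i h ν)

/-- `x_{a,ν}` with a natural-number index (junk value `0` when out of range). -/
def Xn (k : Type) [CommRing k] (a : ℕ) (ν : Fin n → I) : FA k I n :=
  if h : a < n then Xg k ⟨a, h⟩ ν else 0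

/-- `τ_{i,ν}` with a natural-number index (junk value `0` when out of range). -/
def Tn (k : Type) [CommRing k] (i : ℕ) (ν : Fin n → I) : FA k I n :=
  if h : i + 1 < n then Tg k i h ν else 0

/-- The action of the transposition `s_i = (i, i+1)` on sequences `ν ∈ I^n`. -/
def swapSeq (i : ℕ) (ν : Fin n → I) : Fin n → I :=
  if h : i + 1 < n then ν ∘ (Equiv.swap (⟨i, by omega⟩ : Fin n) ⟨i + 1, h⟩) else ν

/-- Evaluation of a polynomial `Q ∈ k[u,v]` at the pair `(a, b)`, localized at
the idempotent `u` (the constant term contributes a multiple of `u`). -/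
noncomputable def pev (Q : MvPolynomial (Fin 2) k) (a b u : FA k I n) : FA k I n :=
  ∑ m ∈ Q.support, Q.coeff m • (a ^ m 0 * b ^ m 1 * u)

/-- Evaluation of the divided difference
`(Q(xhi, xmid) - Q(xlo, xmid))/(xhi - xlo)`, localized at the idempotent `u`. -/
noncomputable def pevDiff (Q : MvPolynomial (Fin 2) k) (xlo xmid xhi u : FA k I n) :
    FA k I n :=
  ∑ m ∈ Q.support, Q.coeff m •
    ((∑ t ∈ Finset.range (m 0), xhi ^ t * xlo ^ (m 0 - 1 - t)) * xmid ^ m 1 * u)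

/-- The defining relations of `H_n(Q)`. -/
inductive Rel (Q : I → I → MvPolynomial (Fin 2) k) : FA k I n → FA k I n → Prop
  | unit_mul_self (ν : Fin n → I) :
      Rel Q (E k ν * E k ν) (E k ν)
  | unit_mul_ne (ν ν' : Fin n → I) (h : ν ≠ ν') :
      Rel Q (E k ν * E k ν') 0
  | tau_sandwich (i : ℕ) (h : i + 1 < n) (ν : Fin n → I) :
      Rel Q (Tg k i h ν) (E k (swapSeq i ν) * Tg k i h ν * E k ν)
  | x_sandwich (a : Fin n) (ν : Fin n → I) :
      Rel Q (Xg k a ν) (E k ν * Xg k a ν * E k ν)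
  | x_comm (a b : Fin n) (ν : Fin n → I) :
      Rel Q (Xg k a ν * Xg k b ν) (Xg k b ν * Xg k a ν)
  | tau_sq (i : ℕ) (h : i + 1 < n) (ν : Fin n → I) :
      Rel Q (Tg k i h (swapSeq i ν) * Tg k i h ν)
        (pev (Q (ν ⟨i, by omega⟩) (ν ⟨i + 1, h⟩)) (Xn k i ν) (Xn k (i + 1) ν) (E k ν))
  | tau_far (i j : ℕ) (hi : i + 1 < n) (hj : j + 1 < n) (hij : i + 2 ≤ j) (ν : Fin n → I) :
      Rel Q (Tg k i hi (swapSeq j ν) * Tg k j hj ν)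
        (Tg k j hj (swapSeq i ν) * Tg k i hi ν)
  | braid_eq (i : ℕ) (h : i + 2 < n) (ν : Fin n → I)
      (hv : ν ⟨i, by omega⟩ = ν ⟨i + 2, h⟩) :
      Rel Q
        (Tg k (i + 1) (by omega) (swapSeq i (swapSeq (i + 1) ν)) *
            Tg k i (by omega) (swapSeq (i + 1) ν) * Tg k (i + 1) (by omega) ν)
        (Tg k i (by omega) (swapSeq (i + 1) (swapSeq i ν)) *
            Tg k (i + 1) (by omega) (swapSeq i ν) * Tg k i (by omega) ν +
          pevDiff (Q (ν ⟨i, by omega⟩) (ν ⟨i + 1, by omega⟩))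
            (Xn k i ν) (Xn k (i + 1) ν) (Xn k (i + 2) ν) (E k ν))
  | braid_ne (i : ℕ) (h : i + 2 < n) (ν : Fin n → I)
      (hv : ν ⟨i, by omega⟩ ≠ ν ⟨i + 2, h⟩) :
      Rel Q
        (Tg k (i + 1) (by omega) (swapSeq i (swapSeq (i + 1) ν)) *
            Tg k i (by omega) (swapSeq (i + 1) ν) * Tg k (i + 1) (by omega) ν)
        (Tg k i (by omega) (swapSeq (i + 1) (swapSeq i ν)) *
            Tg k (i + 1) (by omega) (swapSeq i ν) * Tg k i (by omega) ν)
  | tau_x_i (i : ℕ) (h : i + 1 < n) (ν : Fin n → I)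
      (hv : ν ⟨i, by omega⟩ = ν ⟨i + 1, h⟩) :
      Rel Q (Tg k i h ν * Xn k i ν)
        (Xn k (i + 1) (swapSeq i ν) * Tg k i h ν - E k ν)
  | tau_x_i1 (i : ℕ) (h : i + 1 < n) (ν : Fin n → I)
      (hv : ν ⟨i, by omega⟩ = ν ⟨i + 1, h⟩) :
      Rel Q (Tg k i h ν * Xn k (i + 1) ν)
        (Xn k i (swapSeq i ν) * Tg k i h ν + E k ν)
  | tau_x_other (i : ℕ) (h : i + 1 < n) (a : Fin n) (ν : Fin n → I)
      (hv : (a.val ≠ i ∧ a.val ≠ i + 1) ∨ ν ⟨i, by omega⟩ ≠ ν ⟨i + 1, h⟩) :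
      Rel Q (Tg k i h ν * Xg k a ν)
        (Xg k (Equiv.swap (⟨i, by omega⟩ : Fin n) ⟨i + 1, h⟩ a) (swapSeq i ν) * Tg k i h ν)

/-- The algebra `H_n(Q)`, as a quotient of the free algebra by the defining
relations. -/
abbrev HQ (k : Type) [CommRing k] (I : Type) (n : ℕ)
    (Q : I → I → MvPolynomial (Fin 2) k) :=
  RingQuot (Rel (k := k) (I := I) (n := n) Q)

/-- The quotient map. -/
noncomputable def mk (Q : I → I → MvPolynomial (Fin 2) k) : FA k I n →ₐ[k] HQ k I n Q :=
  RingQuot.mkAlgHom k (Rel Q)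

/-- `Q` is hermitian: `Q_{ij}(u,v) = Q_{ji}(v,u)`. -/
def Hermitian (Q : I → I → MvPolynomial (Fin 2) k) : Prop :=
  ∀ i j, Q i j = MvPolynomial.rename (Equiv.swap (0 : Fin 2) 1) (Q j i)

/-- The (possibly non-unital) algebra `H_n(Q)` proper: the non-unital subalgebra
of the presented algebra generated by the generators. -/
noncomputable def Hgen (Q : I → I → MvPolynomial (Fin 2) k) :
    NonUnitalSubalgebra k (HQ k I n Q) :=
  NonUnitalAlgebra.adjoin k (Set.range fun g : Gen I n => mk Q (FreeAlgebra.ι k g))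

/-- The permutation of `Fin n` given by a word in the Coxeter generators. -/
def permOfWord (n : ℕ) (l : List ℕ) : Equiv.Perm (Fin n) :=
  (l.map fun i =>
    if h : i + 1 < n then Equiv.swap (⟨i, by omega⟩ : Fin n) ⟨i + 1, h⟩ else 1).prod

/-- `l` is a reduced word for the permutation `w`. -/
def IsReducedWordFor (n : ℕ) (l : List ℕ) (w : Equiv.Perm (Fin n)) : Prop :=
  (∀ i ∈ l, i + 1 < n) ∧ permOfWord n l = w ∧
    ∀ l' : List ℕ, (∀ i ∈ l', i + 1 < n) → permOfWord n l' = w → l.length ≤ l'.length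

/-- Action of a word of simple transpositions on a sequence. -/
def seqActWord : List ℕ → (Fin n → I) → (Fin n → I)
  | [], ν => ν
  | i :: l, ν => swapSeq i (seqActWord l ν)

/-- `τ_{i_1, s_{i_2}⋯s_{i_r}(ν)} ⋯ τ_{i_{r-1}, s_{i_r}(ν)} τ_{i_r, ν}` for a word
`l = [i_1, …, i_r]`; the empty word gives the idempotent `1_ν`. -/
noncomputable def tauWord (k : Type) [CommRing k] : List ℕ → (Fin n → I) → FA k I n
  | [], ν => E k ν
  | i :: l, ν => Tn k i (seqActWord l ν) * tauWord k l ν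

/-- The standard reduced word for the longest element of `S_m` (0-based). -/
def longWord (m : ℕ) : List ℕ :=
  (List.range m).foldr (fun j acc => (List.range j).reverse ++ acc) []

end Rouq

namespace Rouq

/-- The simple transposition `(i, i+1)` of `Fin n` (the identity when out of range). -/
def simpleSwap (n i : ℕ) : Equiv.Perm (Fin n) :=
  if h : i + 1 < n then Equiv.swap (⟨i, by omega⟩ : Fin n) ⟨i + 1, h⟩ else 1

theorem simpleSwap_of_lt {n i : ℕ} (h : i + 1 < n) :
    simpleSwap n i = Equiv.swap (⟨i, by omega⟩ : Fin n) ⟨i + 1, h⟩ := dif_pos h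

@[simp] theorem simpleSwap_mul_self (n i : ℕ) : simpleSwap n i * simpleSwap n i = 1 := by
  unfold simpleSwap; split <;> simp

@[simp] theorem simpleSwap_inv (n i : ℕ) : (simpleSwap n i)⁻¹ = simpleSwap n i :=
  inv_eq_of_mul_eq_one_left (simpleSwap_mul_self n i)

@[simp] theorem simpleSwap_simpleSwap (n i : ℕ) (a : Fin n) :
    simpleSwap n i (simpleSwap n i a) = a := by
  rw [← Equiv.Perm.mul_apply, simpleSwap_mul_self, Equiv.Perm.one_apply]

@[simp] theorem simpleSwap_left {n i : ℕ} (h : i + 1 < n) :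
    simpleSwap n i ⟨i, by omega⟩ = ⟨i + 1, h⟩ := by
  rw [simpleSwap_of_lt h, Equiv.swap_apply_left]

@[simp] theorem simpleSwap_right {n i : ℕ} (h : i + 1 < n) :
    simpleSwap n i ⟨i + 1, h⟩ = ⟨i, by omega⟩ := by
  rw [simpleSwap_of_lt h, Equiv.swap_apply_right]

theorem simpleSwap_of_ne {n i : ℕ} {a : Fin n} (h₁ : a.val ≠ i) (h₂ : a.val ≠ i + 1) :
    simpleSwap n i a = a := by
  unfold simpleSwap
  split
  · exact Equiv.swap_apply_of_ne_of_ne (fun e => h₁ (by rw [e])) (fun e => h₂ (by rw [e]))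
  · rfl

theorem simpleSwap_val {n i : ℕ} (h : i + 1 < n) (a : Fin n) :
    (simpleSwap n i a).val = if a.val = i then i + 1 else if a.val = i + 1 then i else a.val := by
  split_ifs with h₁ h₂
  · rw [show a = ⟨i, by omega⟩ from Fin.ext h₁, simpleSwap_left h]
  · rw [show a = ⟨i + 1, h⟩ from Fin.ext h₂, simpleSwap_right h]
  · rw [simpleSwap_of_ne h₁ h₂]

theorem simpleSwap_lt {n i : ℕ} (h : i + 1 < n) {a b : Fin n} (hab : a < b)
    (hne : ¬(a.val = i ∧ b.val = i + 1)) : simpleSwap n i a < simpleSwap n i b := by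
  rw [Fin.lt_def] at hab ⊢
  rw [simpleSwap_val h, simpleSwap_val h]
  split_ifs <;> omega

theorem simpleSwap_comm {n i j : ℕ} (hj : j + 1 < n) (hij : i + 2 ≤ j) :
    simpleSwap n i * simpleSwap n j = simpleSwap n j * simpleSwap n i := by
  have hi : i + 1 < n := by omega
  ext a
  simp only [Equiv.Perm.mul_apply, simpleSwap_val hi, simpleSwap_val hj]
  split_ifs <;> omega

theorem simpleSwap_braid {n i : ℕ} (h : i + 2 < n) :
    simpleSwap n (i + 1) * simpleSwap n i * simpleSwap n (i + 1) =
      simpleSwap n i * simpleSwap n (i + 1) * simpleSwap n i := by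
  have hi : i + 1 < n := by omega
  ext a
  simp only [Equiv.Perm.mul_apply, simpleSwap_val hi, simpleSwap_val (show i + 1 + 1 < n from h)]
  split_ifs <;> omega

theorem swapSeq_eq {I : Type} {n : ℕ} (i : ℕ) (ν : Fin n → I) :
    swapSeq i ν = ν ∘ simpleSwap n i := by
  unfold swapSeq simpleSwap
  split <;> rfl

@[simp] theorem swapSeq_swapSeq {I : Type} {n : ℕ} (i : ℕ) (ν : Fin n → I) :
    swapSeq i (swapSeq i ν) = ν := by
  ext a; simp [swapSeq_eq]

theorem permOfWord_nil (n : ℕ) : permOfWord n [] = 1 := rfl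

theorem permOfWord_cons (n i : ℕ) (l : List ℕ) :
    permOfWord n (i :: l) = simpleSwap n i * permOfWord n l := by
  simp [permOfWord, simpleSwap]

theorem permOfWord_cons_inv (n i : ℕ) (l : List ℕ) :
    (permOfWord n (i :: l))⁻¹ = (permOfWord n l)⁻¹ * simpleSwap n i := by
  simp [permOfWord_cons]

theorem seqActWord_eq {I : Type} {n : ℕ} (l : List ℕ) (ν : Fin n → I) :
    seqActWord l ν = ν ∘ ⇑(permOfWord n l)⁻¹ := by
  induction l with
  | nil => rfl
  | cons i l ih => rw [permOfWord_cons_inv, seqActWord, swapSeq_eq, ih]; rfl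

/-- The number of inversions of a permutation of `Fin n`. -/
def invCount {n : ℕ} (g : Equiv.Perm (Fin n)) : ℕ :=
  (Finset.univ.filter fun p : Fin n × Fin n => p.1 < p.2 ∧ g p.2 < g p.1).card

@[simp] theorem invCount_one {n : ℕ} : invCount (1 : Equiv.Perm (Fin n)) = 0 := by
  simp only [invCount, Finset.card_eq_zero, Finset.filter_eq_empty_iff]
  intro p _ h
  exact absurd h.1 (not_lt.2 h.2.le)

theorem invCount_mul_of_lt {n i : ℕ} (h : i + 1 < n) {g : Equiv.Perm (Fin n)}
    (hg : g ⟨i, by omega⟩ < g ⟨i + 1, h⟩) : invCount (g * simpleSwap n i) = invCount g + 1 := by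
  set s := simpleSwap n i with hs
  have key : (Finset.univ.filter fun p : Fin n × Fin n =>
        p.1 < p.2 ∧ (g * s) p.2 < (g * s) p.1) =
      insert (⟨i, by omega⟩, ⟨i + 1, h⟩) ((Finset.univ.filter fun p : Fin n × Fin n =>
        p.1 < p.2 ∧ g p.2 < g p.1).map (s.prodCongr s).toEmbedding) := by
    ext ⟨a, b⟩
    rw [Finset.mem_filter]
    simp only [Finset.mem_filter, Finset.mem_univ, true_and, Finset.mem_insert,
      Finset.mem_map_equiv, Prod.mk.injEq, Equiv.Perm.mul_apply, Equiv.prodCongr_symm,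
      Equiv.prodCongr_apply, Prod.map_apply]
    have hsymm : s.symm = s := by rw [hs]; exact simpleSwap_inv n i
    rw [hsymm]
    by_cases hab : a.val = i ∧ b.val = i + 1
    · rw [show a = ⟨i, Nat.lt_of_succ_lt h⟩ from Fin.ext hab.1,
        show b = ⟨i + 1, h⟩ from Fin.ext hab.2]
      simp [hs, h, hg]
    · have hne : ¬(a = ⟨i, by omega⟩ ∧ b = ⟨i + 1, h⟩) := by
        simpa [Fin.ext_iff] using hab
      simp only [hne, false_or]
      refine ⟨fun hh => ⟨simpleSwap_lt h hh.1 hab, hh.2⟩, fun hh => ⟨?_, hh.2⟩⟩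
      by_contra hba
      have := hh.1
      rw [Fin.lt_def, simpleSwap_val h, simpleSwap_val h] at this
      rw [Fin.lt_def] at hba
      have h2 := hh.2
      split_ifs at this <;> try omega
      rename_i e₁ e₂ e₃
      · rw [show a = ⟨i + 1, h⟩ from Fin.ext (by omega),
          show b = ⟨i, by omega⟩ from Fin.ext (by omega)] at h2
        simp [hs, h] at h2
        exact absurd hg (not_lt.2 h2.le)
  rw [invCount, key, Finset.card_insert_of_notMem, Finset.card_map, invCount]
  have hsymm : s.symm = s := by rw [hs]; exact simpleSwap_inv n i
  rw [Finset.mem_map_equiv, Finset.mem_filter]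
  rintro ⟨-, hlt, -⟩
  rw [Equiv.prodCongr_symm, hsymm] at hlt
  simp [hs, h] at hlt

theorem invCount_mul_of_gt {n i : ℕ} (h : i + 1 < n) {g : Equiv.Perm (Fin n)}
    (hg : g ⟨i + 1, h⟩ < g ⟨i, by omega⟩) : invCount g = invCount (g * simpleSwap n i) + 1 := by
  rw [← invCount_mul_of_lt h, mul_assoc, simpleSwap_mul_self, mul_one]
  simpa [h] using hg

theorem lt_or_gt_of_succ {n i : ℕ} (h : i + 1 < n) (g : Equiv.Perm (Fin n)) :
    g ⟨i, by omega⟩ < g ⟨i + 1, h⟩ ∨ g ⟨i + 1, h⟩ < g ⟨i, by omega⟩ := by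
  refine lt_or_gt_of_ne fun e => ?_
  have := congrArg Fin.val (g.injective e)
  simp at this

theorem invCount_mul_le {n i : ℕ} (h : i + 1 < n) (g : Equiv.Perm (Fin n)) :
    invCount (g * simpleSwap n i) ≤ invCount g + 1 := by
  rcases lt_or_gt_of_succ h g with hg | hg
  · exact (invCount_mul_of_lt h hg).le
  · have := invCount_mul_of_gt h hg
    omega

theorem eq_one_of_forall_lt {n : ℕ} {g : Equiv.Perm (Fin n)}
    (hg : ∀ i (h : i + 1 < n), g ⟨i, by omega⟩ < g ⟨i + 1, h⟩) : g = 1 := by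
  have mono : StrictMono g := by
    have : ∀ d a (h : a + (d + 1) < n), g ⟨a, by omega⟩ < g ⟨a + (d + 1), h⟩ := by
      intro d
      induction d with
      | zero => intro a h; exact hg a h
      | succ d ih => intro a h; exact (ih a (by omega)).trans (hg (a + (d + 1)) h)
    intro a b hab
    obtain ⟨d, hd⟩ := Nat.exists_eq_add_of_lt (Fin.lt_def.1 hab)
    have := this d a (by omega)
    rwa [show b = ⟨a + (d + 1), by omega⟩ from Fin.ext hd]
  have := Subsingleton.elim (mono.orderIsoOfSurjective g g.surjective) (OrderIso.refl _)
  ext a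
  simpa using congrArg (fun e : Fin n ≃o Fin n => (e a).val) this

theorem exists_reduced {n : ℕ} (g : Equiv.Perm (Fin n)) :
    ∃ l : List ℕ, (∀ i ∈ l, i + 1 < n) ∧ (permOfWord n l)⁻¹ = g ∧ l.length = invCount g := by
  induction hN : invCount g generalizing g with
  | zero =>
    refine ⟨[], by simp, ?_, rfl⟩
    rw [permOfWord_nil, inv_one, eq_comm]
    refine eq_one_of_forall_lt fun i h => (lt_or_gt_of_succ h g).resolve_right fun hgt => ?_
    have := invCount_mul_of_gt h hgt
    omega
  | succ N ih =>
    by_cases hd : ∀ i (h : i + 1 < n), g ⟨i, by omega⟩ < g ⟨i + 1, h⟩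
    · rw [eq_one_of_forall_lt hd, invCount_one] at hN
      omega
    · push Not at hd
      obtain ⟨i, h, hi⟩ := hd
      have hi' := (lt_or_gt_of_succ h g).resolve_left (not_lt.2 hi)
      have := invCount_mul_of_gt h hi'
      obtain ⟨l, h₁, h₂, h₃⟩ := ih (g * simpleSwap n i) (by omega)
      refine ⟨i :: l, by simpa [h] using h₁, ?_, by simp [h₃]⟩
      rw [permOfWord_cons_inv, h₂, mul_assoc, simpleSwap_mul_self, mul_one]

theorem invCount_le_length {n : ℕ} {l : List ℕ} (hl : ∀ i ∈ l, i + 1 < n) :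
    invCount (permOfWord n l)⁻¹ ≤ l.length := by
  induction l with
  | nil => simp [permOfWord_nil]
  | cons i l ih =>
    rw [permOfWord_cons_inv, List.length_cons]
    have := ih fun j hj => hl j (by simp [hj])
    have := invCount_mul_le (hl i (by simp)) (permOfWord n l)⁻¹
    omega

theorem IsReducedWordFor.length_eq {n : ℕ} {l : List ℕ} {w : Equiv.Perm (Fin n)}
    (h : IsReducedWordFor n l w) : l.length = invCount w⁻¹ := by
  obtain ⟨l', h₁, h₂, h₃⟩ := exists_reduced w⁻¹
  refine le_antisymm (h₃ ▸ h.2.2 l' h₁ (inv_injective h₂)) ?_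
  have := invCount_le_length h.1
  rwa [h.2.1] at this

section Algebra
variable {k : Type} [CommRing k] {I : Type} {n : ℕ} (Q : I → I → MvPolynomial (Fin 2) k)

theorem mk_rel {a b : FA k I n} (h : Rel Q a b) : mk Q a = mk Q b :=
  RingQuot.mkAlgHom_rel k h

theorem mk_E_mul_E (ν : Fin n → I) : mk Q (E k ν) * mk Q (E k ν) = mk Q (E k ν) := by
  rw [← map_mul, mk_rel Q (Rel.unit_mul_self ν)]

theorem mk_E_mul_E_of_ne {ν μ : Fin n → I} (h : ν ≠ μ) : mk Q (E k ν) * mk Q (E k μ) = 0 := by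
  rw [← map_mul, mk_rel Q (Rel.unit_mul_ne ν μ h), map_zero]

theorem mk_Xg (a : Fin n) (ν : Fin n → I) :
    mk Q (Xg k a ν) = mk Q (E k ν) * mk Q (Xg k a ν) * mk Q (E k ν) := by
  rw [← map_mul, ← map_mul, ← mk_rel Q (Rel.x_sandwich a ν)]

theorem mk_E_mul_Xg (a : Fin n) (ν : Fin n → I) :
    mk Q (E k ν) * mk Q (Xg k a ν) = mk Q (Xg k a ν) := by
  rw [mk_Xg, ← mul_assoc, ← mul_assoc, mk_E_mul_E]

theorem mk_Xg_mul_E (a : Fin n) (ν : Fin n → I) :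
    mk Q (Xg k a ν) * mk Q (E k ν) = mk Q (Xg k a ν) := by
  rw [mk_Xg, mul_assoc, mk_E_mul_E]

theorem mk_Tg (i : ℕ) (h : i + 1 < n) (ν : Fin n → I) :
    mk Q (Tg k i h ν) = mk Q (E k (swapSeq i ν)) * mk Q (Tg k i h ν) * mk Q (E k ν) := by
  rw [← map_mul, ← map_mul, ← mk_rel Q (Rel.tau_sandwich i h ν)]

theorem mk_E_mul_Tg (i : ℕ) (h : i + 1 < n) (ν : Fin n → I) :
    mk Q (E k (swapSeq i ν)) * mk Q (Tg k i h ν) = mk Q (Tg k i h ν) := by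
  rw [mk_Tg, ← mul_assoc, ← mul_assoc, mk_E_mul_E]

theorem mk_Tg_mul_E (i : ℕ) (h : i + 1 < n) (ν : Fin n → I) :
    mk Q (Tg k i h ν) * mk Q (E k ν) = mk Q (Tg k i h ν) := by
  rw [mk_Tg, mul_assoc, mk_E_mul_E]

theorem Tn_of_lt {i : ℕ} (h : i + 1 < n) (ν : Fin n → I) : Tn k i ν = Tg k i h ν := dif_pos h

theorem Xn_of_lt {a : ℕ} (h : a < n) (ν : Fin n → I) : Xn k a ν = Xg k ⟨a, h⟩ ν := dif_pos h

theorem mk_Xg_comm (ν : Fin n → I) :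
    ∀ a ∈ Set.range (fun b => mk Q (Xg k b ν)), ∀ b ∈ Set.range (fun b => mk Q (Xg k b ν)),
      a * b = b * a := by
  rintro _ ⟨a, rfl⟩ _ ⟨b, rfl⟩
  rw [← map_mul, mk_rel Q (Rel.x_comm a b ν), map_mul]

/-- Evaluation of polynomials at the commuting elements `x_{1,ν}, …, x_{n,ν}`. -/
noncomputable def polyEval (ν : Fin n → I) : MvPolynomial (Fin n) k →ₐ[k] HQ k I n Q :=
  letI : CommRing (Algebra.adjoin k (Set.range fun b => mk Q (Xg k b ν))) :=
    { Subalgebra.toRing _ with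
      mul_comm := (Algebra.isMulCommutative_adjoin k (mk_Xg_comm Q ν)).is_comm.comm }
  (Algebra.adjoin k (Set.range fun b => mk Q (Xg k b ν))).val.comp
    (MvPolynomial.aeval fun b => ⟨mk Q (Xg k b ν), Algebra.subset_adjoin ⟨b, rfl⟩⟩)

@[simp] theorem polyEval_X (ν : Fin n → I) (a : Fin n) :
    polyEval Q ν (MvPolynomial.X a) = mk Q (Xg k a ν) := by
  simp [polyEval]

theorem monomial_eq_prod_ofFn (a : Fin n → ℕ) :
    (MvPolynomial.monomial (Finsupp.equivFunOnFinite.symm a) 1 : MvPolynomial (Fin n) k) =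
      (List.ofFn fun b => MvPolynomial.X b ^ a b).prod := by
  rw [List.prod_ofFn, MvPolynomial.monomial_eq, Finsupp.prod_fintype _ _ (by simp)]
  simp

theorem mk_prod_ofFn (ν : Fin n → I) (a : Fin n → ℕ) :
    mk Q (List.ofFn fun b => Xg k b ν ^ a b).prod =
      polyEval Q ν (MvPolynomial.monomial (Finsupp.equivFunOnFinite.symm a) 1) := by
  rw [monomial_eq_prod_ofFn, map_list_prod, map_list_prod, List.map_ofFn, List.map_ofFn]
  congr 2
  ext b
  simp

theorem mk_E_mul_polyEval (ν : Fin n → I) (f : MvPolynomial (Fin n) k) :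
    mk Q (E k ν) * polyEval Q ν f = polyEval Q ν f * mk Q (E k ν) := by
  induction f using MvPolynomial.induction_on with
  | C r => rw [MvPolynomial.C_eq_algebraMap, AlgHom.commutes, Algebra.commutes]
  | add f g hf hg => rw [map_add, mul_add, add_mul, hf, hg]
  | mul_X f a hf =>
    rw [map_mul, ← mul_assoc, hf, polyEval_X, mul_assoc, mul_assoc, mk_E_mul_Xg, mk_Xg_mul_E]

theorem mk_pev (ν : Fin n → I) (P : MvPolynomial (Fin 2) k) {a b : ℕ} (ha : a < n) (hb : b < n) :
    mk Q (pev P (Xn k a ν) (Xn k b ν) (E k ν)) =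
      polyEval Q ν (MvPolynomial.rename ![⟨a, ha⟩, ⟨b, hb⟩] P) * mk Q (E k ν) := by
  conv_rhs => rw [MvPolynomial.as_sum P]
  simp only [pev, map_sum, Finset.sum_mul, map_smul, map_mul, map_pow, Xn_of_lt ha, Xn_of_lt hb]
  refine Finset.sum_congr rfl fun m _ => ?_
  rw [MvPolynomial.monomial_eq, Finsupp.prod_fintype _ _ (by simp)]
  simp only [← MvPolynomial.algebraMap_eq, map_mul, AlgHom.commutes, Fin.prod_univ_two, map_pow,
    MvPolynomial.rename_X, polyEval_X, Algebra.smul_def, mul_assoc]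
  rfl

theorem exists_Xg_mul_Tg (i : ℕ) (h : i + 1 < n) (a : Fin n) (ν : Fin n → I) :
    ∃ c : k, mk Q (Xg k a (swapSeq i ν)) * mk Q (Tg k i h ν) =
      mk Q (Tg k i h ν) * mk Q (Xg k (simpleSwap n i a) ν) + c • mk Q (E k ν) := by
  by_cases hv : ((simpleSwap n i a).val ≠ i ∧ (simpleSwap n i a).val ≠ i + 1) ∨
      ν ⟨i, by omega⟩ ≠ ν ⟨i + 1, h⟩
  · refine ⟨0, ?_⟩
    have := mk_rel Q (Rel.tau_x_other i h (simpleSwap n i a) ν hv)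
    rw [← simpleSwap_of_lt h, simpleSwap_simpleSwap, map_mul, map_mul] at this
    rw [this, zero_smul, add_zero]
  · simp only [not_or, not_and_or, not_not] at hv
    obtain ⟨ha | ha, hv⟩ := hv
    · refine ⟨1, ?_⟩
      have := mk_rel Q (Rel.tau_x_i i h ν hv)
      have ea : simpleSwap n i a = ⟨i, by omega⟩ := Fin.ext ha
      have eb : a = ⟨i + 1, h⟩ := by rw [← simpleSwap_simpleSwap n i a, ea, simpleSwap_left h]
      rw [Xn_of_lt (by omega), Xn_of_lt h, map_sub, map_mul, map_mul, ← ea, ← eb] at this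
      rw [this, one_smul, sub_add_cancel]
    · refine ⟨-1, ?_⟩
      have := mk_rel Q (Rel.tau_x_i1 i h ν hv)
      have ea : simpleSwap n i a = ⟨i + 1, h⟩ := Fin.ext ha
      have eb : a = ⟨i, by omega⟩ := by
        simpa [h] using congrArg (simpleSwap n i) ea
      rw [Xn_of_lt h, Xn_of_lt (by omega), map_add, map_mul, map_mul, ← ea, ← eb] at this
      have e : (-1 : k) • mk Q (E k ν) = -mk Q (E k ν) := by
        refine eq_neg_of_add_eq_zero_left ?_
        nth_rw 2 [← one_smul k (mk Q (E k ν))]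
        rw [← add_smul, neg_add_cancel, zero_smul]
      rw [this, e, add_neg_cancel_right]

theorem mk_tauWord_cons {i : ℕ} (h : i + 1 < n) (l : List ℕ) (ν : Fin n → I) :
    mk Q (tauWord k (i :: l) ν) = mk Q (Tg k i h (seqActWord l ν)) * mk Q (tauWord k l ν) := by
  rw [tauWord, map_mul, Tn_of_lt h]

theorem mk_E_mul_tauWord {l : List ℕ} (hl : ∀ i ∈ l, i + 1 < n) (ν : Fin n → I) :
    mk Q (E k (seqActWord l ν)) * mk Q (tauWord k l ν) = mk Q (tauWord k l ν) := by
  cases l with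
  | nil => exact mk_E_mul_E Q ν
  | cons i l =>
    rw [mk_tauWord_cons Q (hl i (by simp)), ← mul_assoc]
    congr 1
    exact mk_E_mul_Tg Q i _ _

theorem mk_tauWord_mul_E (l : List ℕ) (ν : Fin n → I) :
    mk Q (tauWord k l ν) * mk Q (E k ν) = mk Q (tauWord k l ν) := by
  induction l with
  | nil => exact mk_E_mul_E Q ν
  | cons i l ih => rw [tauWord, map_mul, mul_assoc, ih]

/-- The span of the elements `τ_l f` with `l` a word of length less than `r` and `f` a polynomial
in `x_{1,ν}, …, x_{n,ν}`. -/
noncomputable def wordFilt (ν : Fin n → I) (r : ℕ) : Submodule k (HQ k I n Q) :=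
  Submodule.span k {z | ∃ (l : List ℕ) (f : MvPolynomial (Fin n) k), (∀ i ∈ l, i + 1 < n) ∧
    l.length < r ∧ z = mk Q (tauWord k l ν) * polyEval Q ν f}

variable {Q}

theorem mem_wordFilt {ν : Fin n → I} {r : ℕ} {l : List ℕ} (hl : ∀ i ∈ l, i + 1 < n)
    (hr : l.length < r) (f : MvPolynomial (Fin n) k) :
    mk Q (tauWord k l ν) * polyEval Q ν f ∈ wordFilt Q ν r :=
  Submodule.subset_span ⟨l, f, hl, hr, rfl⟩

theorem tauWord_mem_wordFilt {ν : Fin n → I} {r : ℕ} {l : List ℕ} (hl : ∀ i ∈ l, i + 1 < n)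
    (hr : l.length < r) : mk Q (tauWord k l ν) ∈ wordFilt Q ν r := by
  simpa using mem_wordFilt (Q := Q) (ν := ν) hl hr 1

theorem wordFilt_mono {ν : Fin n → I} {r s : ℕ} (h : r ≤ s) : wordFilt Q ν r ≤ wordFilt Q ν s := by
  refine Submodule.span_mono ?_
  rintro _ ⟨l, f, h₁, h₂, rfl⟩
  exact ⟨l, f, h₁, by omega, rfl⟩

theorem wordFilt_induction {ν : Fin n → I} {r : ℕ} {N : Submodule k (HQ k I n Q)}
    (φ : HQ k I n Q →ₗ[k] HQ k I n Q)
    (H : ∀ (l : List ℕ) (f : MvPolynomial (Fin n) k), (∀ i ∈ l, i + 1 < n) → l.length < r →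
      φ (mk Q (tauWord k l ν) * polyEval Q ν f) ∈ N)
    {m : HQ k I n Q} (hm : m ∈ wordFilt Q ν r) : φ m ∈ N := by
  have : wordFilt Q ν r ≤ N.comap φ := by
    refine Submodule.span_le.2 ?_
    rintro _ ⟨l, f, h₁, h₂, rfl⟩
    exact H l f h₁ h₂
  exact this hm

theorem mul_polyEval_mem_wordFilt {ν : Fin n → I} {r : ℕ} (f : MvPolynomial (Fin n) k)
    {m : HQ k I n Q} (hm : m ∈ wordFilt Q ν r) : m * polyEval Q ν f ∈ wordFilt Q ν r := by
  refine wordFilt_induction (LinearMap.mulRight k (polyEval Q ν f)) (fun l g h₁ h₂ => ?_) hm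
  rw [LinearMap.mulRight_apply, mul_assoc, ← map_mul]
  exact mem_wordFilt h₁ h₂ _

theorem E_mul_mem_wordFilt {ν : Fin n → I} {r : ℕ} (μ : Fin n → I)
    {m : HQ k I n Q} (hm : m ∈ wordFilt Q ν r) : mk Q (E k μ) * m ∈ wordFilt Q ν r := by
  refine wordFilt_induction (LinearMap.mulLeft k (mk Q (E k μ))) (fun l g h₁ h₂ => ?_) hm
  rw [LinearMap.mulLeft_apply, ← mul_assoc, ← mk_E_mul_tauWord Q h₁, ← mul_assoc]
  by_cases h : μ = seqActWord l ν
  · rw [h, mk_E_mul_E, mk_E_mul_tauWord Q h₁]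
    exact mem_wordFilt h₁ h₂ _
  · rw [mk_E_mul_E_of_ne Q h, zero_mul, zero_mul]
    exact zero_mem _

theorem Tg_mul_mem_wordFilt {ν : Fin n → I} {r : ℕ} (i : ℕ) (h : i + 1 < n) (μ : Fin n → I)
    {m : HQ k I n Q} (hm : m ∈ wordFilt Q ν r) :
    mk Q (Tg k i h μ) * m ∈ wordFilt Q ν (r + 1) := by
  refine wordFilt_induction (LinearMap.mulLeft k (mk Q (Tg k i h μ))) (fun l g h₁ h₂ => ?_) hm
  rw [LinearMap.mulLeft_apply, ← mul_assoc]
  by_cases hμ : μ = seqActWord l ν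
  · rw [hμ, ← mk_tauWord_cons]
    exact mem_wordFilt (by simpa [h] using h₁) (by simpa using h₂) _
  · rw [← mk_E_mul_tauWord Q h₁, ← mk_Tg_mul_E, mul_assoc (mk Q (Tg k i h μ)),
      ← mul_assoc (mk Q (E k μ)), mk_E_mul_E_of_ne Q hμ, zero_mul, mul_zero, zero_mul]
    exact zero_mem _

theorem Xg_mul_mem_wordFilt {ν : Fin n → I} {r : ℕ} (a : Fin n) (μ : Fin n → I)
    {m : HQ k I n Q} (hm : m ∈ wordFilt Q ν r) : mk Q (Xg k a μ) * m ∈ wordFilt Q ν r := by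
  refine wordFilt_induction (LinearMap.mulLeft k (mk Q (Xg k a μ))) (fun l g h₁ h₂ => ?_) hm
  rw [LinearMap.mulLeft_apply]
  refine wordFilt_mono (Nat.succ_le_of_lt h₂) ?_
  clear h₂
  by_cases hμ : μ = seqActWord l ν
  · subst hμ
    induction l generalizing a with
    | nil =>
      rw [tauWord, seqActWord, ← mul_assoc, mk_Xg_mul_E, ← mk_E_mul_Xg, mul_assoc, ← polyEval_X,
        ← map_mul]
      exact mem_wordFilt (l := []) h₁ (by simp) _
    | cons i l ih =>
      have h := h₁ i (by simp)
      have h₁' : ∀ j ∈ l, j + 1 < n := fun j hj => h₁ j (by simp [hj])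
      obtain ⟨c, hc⟩ := exists_Xg_mul_Tg Q i h a (seqActWord l ν)
      rw [mk_tauWord_cons Q h, seqActWord, ← mul_assoc, ← mul_assoc, hc, add_mul, add_mul,
        smul_mul_assoc, smul_mul_assoc, mk_E_mul_tauWord Q h₁', mul_assoc, mul_assoc]
      refine add_mem (Tg_mul_mem_wordFilt i h _ ?_) (Submodule.smul_mem _ _ ?_)
      · rw [← mul_assoc] at *
        simpa [mul_assoc] using ih _ h₁'
      · exact mem_wordFilt h₁' (by simp) _
  · rw [← mk_E_mul_tauWord Q h₁, ← mk_Xg_mul_E, mul_assoc (mk Q (Xg k a μ)), mul_assoc (mk Q _),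
      ← mul_assoc (mk Q (E k μ)), mk_E_mul_E_of_ne Q hμ, zero_mul, mul_zero]
    exact zero_mem _

/-- The elements of `H_n(Q)` whose left multiplication preserves the filtration by length. -/
def wordFiltStabilizer (Q : I → I → MvPolynomial (Fin 2) k) (ν : Fin n → I) (r : ℕ) :
    Subalgebra k (HQ k I n Q) where
  carrier := {z | ∀ m ∈ wordFilt Q ν r, z * m ∈ wordFilt Q ν r}
  mul_mem' ha hb m hm := by rw [mul_assoc]; exact ha _ (hb _ hm)
  add_mem' ha hb m hm := by rw [add_mul]; exact add_mem (ha _ hm) (hb _ hm)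
  algebraMap_mem' c m hm := by
    rw [← Algebra.smul_def]; exact Submodule.smul_mem _ _ hm

theorem E_mem_stabilizer (ν μ : Fin n → I) (r : ℕ) :
    mk Q (E k μ) ∈ wordFiltStabilizer Q ν r := fun _ => E_mul_mem_wordFilt μ

theorem Xn_mem_stabilizer (ν μ : Fin n → I) (a r : ℕ) :
    mk Q (Xn k a μ) ∈ wordFiltStabilizer Q ν r := by
  unfold Xn
  split
  · exact fun _ => Xg_mul_mem_wordFilt _ μ
  · rw [map_zero]; exact zero_mem _

theorem pev_mem_stabilizer (ν μ : Fin n → I) (P : MvPolynomial (Fin 2) k) (a b r : ℕ) :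
    mk Q (pev P (Xn k a μ) (Xn k b μ) (E k μ)) ∈ wordFiltStabilizer Q ν r := by
  simp only [pev, map_sum, map_smul, map_mul, map_pow]
  exact sum_mem fun m _ => Subalgebra.smul_mem _ (mul_mem (mul_mem
    (pow_mem (Xn_mem_stabilizer _ _ _ _) _) (pow_mem (Xn_mem_stabilizer _ _ _ _) _))
    (E_mem_stabilizer _ _ _)) _

theorem pevDiff_mem_stabilizer (ν μ : Fin n → I) (P : MvPolynomial (Fin 2) k) (a b c r : ℕ) :
    mk Q (pevDiff P (Xn k a μ) (Xn k b μ) (Xn k c μ) (E k μ)) ∈ wordFiltStabilizer Q ν r := by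
  simp only [pevDiff, map_sum, map_smul, map_mul, map_pow]
  exact sum_mem fun m _ => Subalgebra.smul_mem _ (mul_mem (mul_mem
    (sum_mem fun t _ => mul_mem (pow_mem (Xn_mem_stabilizer _ _ _ _) _)
      (pow_mem (Xn_mem_stabilizer _ _ _ _) _)) (pow_mem (Xn_mem_stabilizer _ _ _ _) _))
    (E_mem_stabilizer _ _ _)) _

theorem tauWord_sq_mem_wordFilt (ν : Fin n → I) {i : ℕ} (h : i + 1 < n) {l : List ℕ}
    (hl : ∀ j ∈ l, j + 1 < n) {r : ℕ} (hr : l.length < r) :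
    mk Q (tauWord k (i :: i :: l) ν) ∈ wordFilt Q ν r := by
  rw [mk_tauWord_cons Q h, mk_tauWord_cons Q h, seqActWord, ← mul_assoc, ← map_mul,
    mk_rel Q (Rel.tau_sq i h _)]
  exact pev_mem_stabilizer _ _ _ _ _ _ _ (tauWord_mem_wordFilt hl hr)

theorem tauWord_far (ν : Fin n → I) {i j : ℕ} (hj : j + 1 < n) (hij : i + 2 ≤ j) (l : List ℕ) :
    mk Q (tauWord k (i :: j :: l) ν) = mk Q (tauWord k (j :: i :: l) ν) := by
  have hi : i + 1 < n := by omega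
  rw [mk_tauWord_cons Q hi, mk_tauWord_cons Q hj, mk_tauWord_cons Q hj, mk_tauWord_cons Q hi,
    seqActWord, seqActWord, ← mul_assoc, ← mul_assoc, ← map_mul,
    mk_rel Q (Rel.tau_far i j hi hj hij _), map_mul]

theorem tauWord_braid_sub_mem_wordFilt (ν : Fin n → I) {i : ℕ} (h : i + 2 < n) {l : List ℕ}
    (hl : ∀ j ∈ l, j + 1 < n) {r : ℕ} (hr : l.length < r) :
    mk Q (tauWord k ((i + 1) :: i :: (i + 1) :: l) ν) -
      mk Q (tauWord k (i :: (i + 1) :: i :: l) ν) ∈ wordFilt Q ν r := by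
  have hi : i + 1 < n := by omega
  have hi' : i + 1 + 1 < n := by omega
  simp only [mk_tauWord_cons Q hi, mk_tauWord_cons Q hi', seqActWord, ← mul_assoc]
  by_cases hv : seqActWord l ν ⟨i, by omega⟩ = seqActWord l ν ⟨i + 2, h⟩
  · have e := mk_rel Q (Rel.braid_eq i h _ hv)
    simp only [map_add, map_mul] at e
    rw [e, add_mul, add_sub_cancel_left]
    exact pevDiff_mem_stabilizer _ _ _ _ _ _ _ _ (tauWord_mem_wordFilt hl hr)
  · have e := mk_rel Q (Rel.braid_ne i h _ hv)
    simp only [map_mul] at e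
    rw [e, sub_self]
    exact zero_mem _

theorem tauWord_cons_sub_mem_wordFilt {ν : Fin n → I} {i r : ℕ} (h : i + 1 < n) {l l' : List ℕ}
    (hw : permOfWord n l = permOfWord n l')
    (hm : mk Q (tauWord k l ν) - mk Q (tauWord k l' ν) ∈ wordFilt Q ν r) :
    mk Q (tauWord k (i :: l) ν) - mk Q (tauWord k (i :: l') ν) ∈ wordFilt Q ν (r + 1) := by
  have e : seqActWord l ν = seqActWord l' ν := by rw [seqActWord_eq, seqActWord_eq, hw]
  rw [mk_tauWord_cons Q h, mk_tauWord_cons Q h, e, ← mul_sub]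
  exact Tg_mul_mem_wordFilt i h _ hm

theorem permOfWord_cons_eq {g : Equiv.Perm (Fin n)} {i : ℕ} {l : List ℕ}
    (hg : (permOfWord n l)⁻¹ = g * simpleSwap n i) : (permOfWord n (i :: l))⁻¹ = g := by
  rw [permOfWord_cons_inv, hg, mul_assoc, simpleSwap_mul_self, mul_one]

theorem permOfWord_inv_of_cons {g : Equiv.Perm (Fin n)} {i : ℕ} {l : List ℕ}
    (hg : (permOfWord n (i :: l))⁻¹ = g) : (permOfWord n l)⁻¹ = g * simpleSwap n i := by
  rw [← hg, permOfWord_cons_inv, mul_assoc, simpleSwap_mul_self, mul_one]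

theorem descent_of_reduced_cons {g : Equiv.Perm (Fin n)} {i : ℕ} {l : List ℕ} (h : i + 1 < n)
    (hl : ∀ j ∈ l, j + 1 < n) (hg : (permOfWord n (i :: l))⁻¹ = g)
    (hlen : l.length + 1 = invCount g) : g ⟨i + 1, h⟩ < g ⟨i, by omega⟩ := by
  refine (lt_or_gt_of_succ h g).resolve_left fun hlt => ?_
  have h₁ := invCount_mul_of_lt h hlt
  have h₂ := invCount_le_length hl
  rw [permOfWord_inv_of_cons hg] at h₂
  omega

/-- Any two reduced words for the same permutation give the same product of intertwiners
modulo shorter words. -/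
theorem tauWord_sub_mem_wordFilt (ν : Fin n → I) (r : ℕ) :
    ∀ l l' : List ℕ, (∀ i ∈ l, i + 1 < n) → (∀ i ∈ l', i + 1 < n) → l.length = r → l'.length = r →
      invCount (permOfWord n l)⁻¹ = r → permOfWord n l = permOfWord n l' →
      mk Q (tauWord k l ν) - mk Q (tauWord k l' ν) ∈ wordFilt Q ν r := by
  induction r using Nat.strong_induction_on with
  | _ r IH =>
  -- it suffices to treat words starting with `i ≤ j`
  have key : ∀ (i j : ℕ) (l l' : List ℕ), i ≤ j → (∀ a ∈ i :: l, a + 1 < n) →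
      (∀ a ∈ j :: l', a + 1 < n) → l.length + 1 = r → l'.length + 1 = r →
      invCount (permOfWord n (i :: l))⁻¹ = r →
      permOfWord n (i :: l) = permOfWord n (j :: l') →
      mk Q (tauWord k (i :: l) ν) - mk Q (tauWord k (j :: l') ν) ∈ wordFilt Q ν r := by
    intro i j l l' hij hl hl' hr hr' hinv hw
    have hi : i + 1 < n := hl i (by simp)
    have hj : j + 1 < n := hl' j (by simp)
    replace hl : ∀ a ∈ l, a + 1 < n := fun a ha => hl a (by simp [ha])
    replace hl' : ∀ a ∈ l', a + 1 < n := fun a ha => hl' a (by simp [ha])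
    generalize hg : (permOfWord n (i :: l))⁻¹ = g at hinv
    have hg' : (permOfWord n (j :: l'))⁻¹ = g := by rw [← hw, hg]
    have hlg := permOfWord_inv_of_cons hg
    have hlg' := permOfWord_inv_of_cons hg'
    have di := descent_of_reduced_cons hi hl hg (by omega)
    have dj := descent_of_reduced_cons hj hl' hg' (by omega)
    have ci := invCount_mul_of_gt hi di
    have cj := invCount_mul_of_gt hj dj
    -- replace the tails by other reduced words
    have step : ∀ (a : ℕ) (t u : List ℕ), a + 1 < n → (∀ b ∈ t, b + 1 < n) →
        (∀ b ∈ u, b + 1 < n) → t.length + 1 = r → u.length + 1 = r →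
        invCount (permOfWord n t)⁻¹ + 1 = r → (permOfWord n t)⁻¹ = (permOfWord n u)⁻¹ →
        mk Q (tauWord k (a :: t) ν) - mk Q (tauWord k (a :: u) ν) ∈ wordFilt Q ν r := by
      intro a t u ha ht hu htr hur hti htu
      have := IH t.length (by omega) t u ht hu rfl (by omega) (by omega) (inv_injective htu)
      rw [← htr]
      exact tauWord_cons_sub_mem_wordFilt ha (inv_injective htu) this
    have combine : ∀ {a b c d : HQ k I n Q}, a - b ∈ wordFilt Q ν r → b - c ∈ wordFilt Q ν r →
        d - c ∈ wordFilt Q ν r → a - d ∈ wordFilt Q ν r := by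
      intro a b c d h₁ h₂ h₃
      have := sub_mem (add_mem h₁ h₂) h₃
      rwa [sub_add_sub_cancel, sub_sub_sub_cancel_right] at this
    rcases (by omega : i = j ∨ i + 2 ≤ j ∨ j = i + 1) with rfl | hij | rfl
    · exact step i l l' hi hl hl' hr hr' (by rw [hlg]; omega) (by rw [hlg, hlg'])
    · have dj' : (g * simpleSwap n i) ⟨j + 1, hj⟩ < (g * simpleSwap n i) ⟨j, by omega⟩ := by
        rw [Equiv.Perm.mul_apply, Equiv.Perm.mul_apply, simpleSwap_of_ne, simpleSwap_of_ne]
        · exact dj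
        all_goals simp only [ne_eq]; omega
      have cj' := invCount_mul_of_gt hj dj'
      obtain ⟨m, hm₁, hm₂, hm₃⟩ := exists_reduced (g * simpleSwap n i * simpleSwap n j)
      have hm₂' : (permOfWord n m)⁻¹ = g * simpleSwap n j * simpleSwap n i := by
        rw [hm₂, mul_assoc, mul_assoc, simpleSwap_comm hj hij]
      have e₁ := permOfWord_cons_eq hm₂
      have e₂ := permOfWord_cons_eq hm₂'
      refine combine (step i l (j :: m) hi hl (by simpa [hj] using hm₁) hr
        (by simp only [List.length_cons]; omega) (by rw [hlg]; omega) (by rw [hlg, e₁])) ?_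
        (step j l' (i :: m) hj hl' (by simpa [hi] using hm₁) hr'
        (by simp only [List.length_cons]; omega) (by rw [hlg']; omega) (by rw [hlg', e₂]))
      rw [tauWord_far ν hj hij, sub_self]
      exact zero_mem _
    · have hi₂ : i + 2 < n := hj
      have hs₁ : simpleSwap n i ⟨i + 2, hi₂⟩ = ⟨i + 2, hi₂⟩ :=
        simpleSwap_of_ne (by simp) (by simp)
      have hs₂ : simpleSwap n (i + 1) ⟨i, by omega⟩ = ⟨i, by omega⟩ :=
        simpleSwap_of_ne (by simp) (by simp only [ne_eq]; omega)
      have hs₃ : simpleSwap n (i + 1) ⟨i + 1, hi⟩ = ⟨i + 2, hi₂⟩ := simpleSwap_left hj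
      have d₁ : (g * simpleSwap n i) ⟨i + 1 + 1, hj⟩ < (g * simpleSwap n i) ⟨i + 1, hi⟩ := by
        rw [Equiv.Perm.mul_apply, Equiv.Perm.mul_apply, simpleSwap_right hi, hs₁]
        exact dj.trans di
      have c₁ := invCount_mul_of_gt hj d₁
      have d₂ : (g * simpleSwap n i * simpleSwap n (i + 1)) ⟨i + 1, hi⟩ <
          (g * simpleSwap n i * simpleSwap n (i + 1)) ⟨i, by omega⟩ := by
        simp only [Equiv.Perm.mul_apply, hs₁, hs₂, hs₃, simpleSwap_left hi]
        exact dj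
      have c₂ := invCount_mul_of_gt hi d₂
      obtain ⟨m, hm₁, hm₂, hm₃⟩ := exists_reduced
        (g * simpleSwap n i * simpleSwap n (i + 1) * simpleSwap n i)
      have hm₂' : (permOfWord n m)⁻¹ =
          g * simpleSwap n (i + 1) * simpleSwap n i * simpleSwap n (i + 1) := by
        rw [hm₂]
        simpa only [mul_assoc] using congrArg (g * ·) (simpleSwap_braid hi₂).symm
      have e₁ := permOfWord_cons_eq (permOfWord_cons_eq hm₂)
      have e₂ := permOfWord_cons_eq (permOfWord_cons_eq hm₂')
      refine combine (step i l ((i + 1) :: i :: m) hi hl (by simpa [hi, hj] using hm₁) hr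
        (by simp only [List.length_cons]; omega) (by rw [hlg]; omega) (by rw [hlg, e₁])) ?_
        (step (i + 1) l' (i :: (i + 1) :: m) hj hl' (by simpa [hi, hj] using hm₁) hr'
        (by simp only [List.length_cons]; omega) (by rw [hlg']; omega) (by rw [hlg', e₂]))
      rw [← neg_mem_iff, neg_sub]
      exact tauWord_braid_sub_mem_wordFilt ν hi₂ hm₁ (by omega)
  intro l l' hl hl' hr hr' hinv hw
  match l, l' with
  | [], [] => rw [sub_self]; exact zero_mem _
  | [], _ :: _ => simp at hr hr'; omega
  | _ :: _, [] => simp at hr hr'; omega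
  | i :: l, j :: l' =>
    rcases le_total i j with hij | hij
    · exact key i j l l' hij hl hl' hr hr' hinv hw
    · rw [← neg_mem_iff, neg_sub]
      exact key j i l' l hij hl' hl hr' hr (by rw [← hw, hinv]) hw.symm

/-- The product of intertwiners along a non-reduced word is a combination of shorter words. -/
theorem tauWord_mem_wordFilt_of_not_reduced (ν : Fin n → I) {l : List ℕ}
    (hl : ∀ i ∈ l, i + 1 < n) (hinv : invCount (permOfWord n l)⁻¹ < l.length) :
    mk Q (tauWord k l ν) ∈ wordFilt Q ν l.length := by
  induction l with
  | nil => simp at hinv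
  | cons i l ih =>
    have hi : i + 1 < n := hl i (by simp)
    replace hl : ∀ a ∈ l, a + 1 < n := fun a ha => hl a (by simp [ha])
    rw [List.length_cons] at hinv ⊢
    rcases (invCount_le_length hl).lt_or_eq with h | h
    · rw [mk_tauWord_cons Q hi]
      exact Tg_mul_mem_wordFilt i hi _ (ih hl h)
    · rw [permOfWord_cons_inv] at hinv
      have d : (permOfWord n l)⁻¹ ⟨i + 1, hi⟩ < (permOfWord n l)⁻¹ ⟨i, by omega⟩ := by
        refine (lt_or_gt_of_succ hi _).resolve_left fun hlt => ?_
        have := invCount_mul_of_lt hi hlt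
        omega
      have c := invCount_mul_of_gt hi d
      obtain ⟨m, hm₁, hm₂, hm₃⟩ := exists_reduced ((permOfWord n l)⁻¹ * simpleSwap n i)
      have e := inv_injective (permOfWord_cons_eq hm₂)
      have h₁ := tauWord_cons_sub_mem_wordFilt hi e.symm (tauWord_sub_mem_wordFilt (Q := Q) ν
        l.length l (i :: m) hl (by simpa [hi] using hm₁) rfl
        (by simp only [List.length_cons]; omega) h e.symm)
      have h₂ := tauWord_sq_mem_wordFilt (Q := Q) ν hi hm₁ (r := l.length + 1) (by omega)
      have := add_mem h₁ h₂
      rwa [sub_add_cancel] at this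

theorem polyEval_eq_sum (ν : Fin n → I) (f : MvPolynomial (Fin n) k) :
    polyEval Q ν f = ∑ v ∈ f.support,
      f.coeff v • mk Q (List.ofFn fun b => Xg k b ν ^ v b).prod := by
  conv_lhs => rw [MvPolynomial.as_sum f, map_sum]
  refine Finset.sum_congr rfl fun v _ => ?_
  rw [mk_prod_ofFn, ← map_smul, MvPolynomial.smul_monomial, smul_eq_mul, mul_one,
    show Finsupp.equivFunOnFinite.symm ⇑v = v from Finsupp.equivFunOnFinite.symm_apply_apply v]

variable {red : Equiv.Perm (Fin n) → List ℕ}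

/-- The span of the elements `τ_w x^a 1_ν` for a choice of reduced words. -/
noncomputable def standardSpan (Q : I → I → MvPolynomial (Fin 2) k)
    (red : Equiv.Perm (Fin n) → List ℕ) : Submodule k (HQ k I n Q) :=
  Submodule.span k (Set.range fun p : Equiv.Perm (Fin n) × (Fin n → ℕ) × (Fin n → I) =>
    mk Q (tauWord k (red p.1) p.2.2 * (List.ofFn fun b : Fin n => Xg k b p.2.2 ^ p.2.1 b).prod))

theorem tauWord_mul_polyEval_mem_standardSpan (w : Equiv.Perm (Fin n)) (ν : Fin n → I)
    (f : MvPolynomial (Fin n) k) :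
    mk Q (tauWord k (red w) ν) * polyEval Q ν f ∈ standardSpan Q red := by
  rw [polyEval_eq_sum, Finset.mul_sum]
  refine sum_mem fun v _ => ?_
  rw [mul_smul_comm, ← map_mul]
  exact Submodule.smul_mem _ _ (Submodule.subset_span ⟨(w, v, ν), rfl⟩)

theorem wordFilt_le_standardSpan (hred : ∀ w, IsReducedWordFor n (red w) w)
    (ν : Fin n → I) (r : ℕ) : wordFilt Q ν r ≤ standardSpan Q red := by
  induction r with
  | zero =>
    refine Submodule.span_le.2 ?_
    rintro _ ⟨l, f, _, h, _⟩
    omega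
  | succ r ih =>
    refine Submodule.span_le.2 ?_
    rintro _ ⟨l, f, hl, h, rfl⟩
    rcases Nat.lt_succ_iff_lt_or_eq.1 h with h | h
    · exact ih (mem_wordFilt hl h f)
    · rcases (invCount_le_length hl).lt_or_eq with hinv | hinv
      · exact ih (mul_polyEval_mem_wordFilt f
          (h ▸ tauWord_mem_wordFilt_of_not_reduced ν hl hinv))
      · have hw := hred (permOfWord n l)
        have := ih (mul_polyEval_mem_wordFilt f (tauWord_sub_mem_wordFilt (Q := Q) ν r l
          (red (permOfWord n l)) hl hw.1 h (by rw [hw.length_eq]; omega) (by omega) hw.2.1.symm))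
        have h₂ := add_mem this
          (tauWord_mul_polyEval_mem_standardSpan (red := red) (permOfWord n l) ν f)
        rwa [sub_mul, sub_add_cancel] at h₂

theorem tauWord_mul_mem_standardSpan (hred : ∀ w, IsReducedWordFor n (red w) w)
    {l : List ℕ} (hl : ∀ i ∈ l, i + 1 < n) (ν : Fin n → I)
    (f : MvPolynomial (Fin n) k) :
    mk Q (tauWord k l ν) * polyEval Q ν f ∈ standardSpan Q red :=
  wordFilt_le_standardSpan hred ν _ (mem_wordFilt hl (Nat.lt_succ_self _) f)

theorem generator_mul_mem_standardSpan (hred : ∀ w, IsReducedWordFor n (red w) w)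
    (g : Gen I n) {m : HQ k I n Q}
    (hm : m ∈ standardSpan Q red) :
    mk Q (FreeAlgebra.ι k g) * m ∈ standardSpan Q red := by
  have : standardSpan Q red ≤
      (standardSpan Q red).comap (LinearMap.mulLeft k (mk Q (FreeAlgebra.ι k g))) := by
    refine Submodule.span_le.2 ?_
    rintro _ ⟨⟨w, a, ν⟩, rfl⟩
    have h₀ := mem_wordFilt (Q := Q) (ν := ν) (hred w).1 (Nat.lt_succ_self _)
      (MvPolynomial.monomial (Finsupp.equivFunOnFinite.symm a) 1)
    rw [← mk_prod_ofFn, ← map_mul] at h₀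
    cases g with
    | unit μ => exact wordFilt_le_standardSpan hred ν _ (E_mul_mem_wordFilt μ h₀)
    | x b μ => exact wordFilt_le_standardSpan hred ν _ (Xg_mul_mem_wordFilt b μ h₀)
    | tau i h μ => exact wordFilt_le_standardSpan hred ν _ (Tg_mul_mem_wordFilt i h μ h₀)
  exact this hm

theorem generator_mem_standardSpan (hred : ∀ w, IsReducedWordFor n (red w) w)
    (g : Gen I n) :
    mk Q (FreeAlgebra.ι k g) ∈ standardSpan Q red := by
  have hE : ∀ ν : Fin n → I, mk Q (E k ν) ∈ standardSpan Q red := fun ν => by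
    simpa [tauWord] using tauWord_mul_mem_standardSpan (Q := Q) hred (l := []) (by simp) ν 1
  cases g with
  | unit μ => exact hE μ
  | x b μ =>
    have := generator_mul_mem_standardSpan hred (Gen.x b μ) (hE μ)
    rwa [← Xg, mk_Xg_mul_E] at this
  | tau i h μ =>
    have := generator_mul_mem_standardSpan hred (Gen.tau i h μ) (hE μ)
    rwa [← Tg, mk_Tg_mul_E] at this

theorem Hgen_mul_mem {z : HQ k I n Q} (hz : z ∈ Hgen Q) (y : FA k I n) :
    z * mk Q y ∈ Hgen Q := by
  induction y using FreeAlgebra.induction generalizing z with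
  | grade0 c =>
    rw [AlgHom.commutes, ← Algebra.commutes, ← Algebra.smul_def]
    exact SMulMemClass.smul_mem c hz
  | grade1 g => exact mul_mem hz (NonUnitalAlgebra.subset_adjoin k ⟨g, rfl⟩)
  | mul a b ha hb => rw [map_mul, ← mul_assoc]; exact hb (ha hz)
  | add a b ha hb => rw [map_add, mul_add]; exact add_mem (ha hz) (hb hz)

theorem mk_tauWord_mem_Hgen (l : List ℕ) (ν : Fin n → I) : mk Q (tauWord k l ν) ∈ Hgen Q := by
  cases l with
  | nil => exact NonUnitalAlgebra.subset_adjoin k ⟨Gen.unit ν, rfl⟩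
  | cons i l =>
    rw [tauWord, map_mul]
    refine Hgen_mul_mem ?_ _
    unfold Tn
    split
    · exact NonUnitalAlgebra.subset_adjoin k ⟨Gen.tau i _ _, rfl⟩
    · rw [map_zero]; exact zero_mem _

theorem standardSpan_eq_Hgen (hred : ∀ w, IsReducedWordFor n (red w) w) :
    standardSpan Q red = (Hgen Q).toSubmodule := by
  refine le_antisymm (Submodule.span_le.2 ?_) fun z hz => ?_
  · rintro _ ⟨p, rfl⟩
    change mk Q (_ * _) ∈ Hgen Q
    rw [map_mul]
    exact Hgen_mul_mem (mk_tauWord_mem_Hgen _ _) _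
  · have : z ∈ standardSpan Q red ∧ ∀ m ∈ standardSpan Q red, z * m ∈ standardSpan Q red := by
      refine NonUnitalAlgebra.adjoin_induction (p := fun z _ => z ∈ standardSpan Q red ∧
        ∀ m ∈ standardSpan Q red, z * m ∈ standardSpan Q red) ?_ ?_ ?_ ?_ ?_ hz
      · rintro _ ⟨g, rfl⟩
        exact ⟨generator_mem_standardSpan hred g, fun m => generator_mul_mem_standardSpan hred g⟩
      · intro x y _ _ hx hy
        exact ⟨add_mem hx.1 hy.1, fun m hm => by
          rw [add_mul]; exact add_mem (hx.2 m hm) (hy.2 m hm)⟩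
      · exact ⟨zero_mem _, fun m _ => by rw [zero_mul]; exact zero_mem _⟩
      · intro x y _ _ hx hy
        exact ⟨hx.2 y hy.1, fun m hm => by rw [mul_assoc]; exact hx.2 _ (hy.2 m hm)⟩
      · intro c x _ hx
        exact ⟨Submodule.smul_mem _ _ hx.1, fun m hm => by
          rw [smul_mul_assoc]; exact Submodule.smul_mem _ _ (hx.2 m hm)⟩
    exact this.1


theorem Tg_mul_polyEval_of_ne {i : ℕ} (h : i + 1 < n) {ν : Fin n → I}
    (hv : ν ⟨i, by omega⟩ ≠ ν ⟨i + 1, h⟩) (f : MvPolynomial (Fin n) k) :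
    mk Q (Tg k i h ν) * polyEval Q ν f =
      polyEval Q (swapSeq i ν) (MvPolynomial.rename (simpleSwap n i) f) * mk Q (Tg k i h ν) := by
  induction f using MvPolynomial.induction_on with
  | C c =>
    rw [MvPolynomial.rename_C, MvPolynomial.C_eq_algebraMap, AlgHom.commutes, AlgHom.commutes,
      Algebra.commutes]
  | add f g hf hg => simp only [map_add, mul_add, add_mul, hf, hg]
  | mul_X f a hf =>
    have := mk_rel Q (Rel.tau_x_other i h a ν (.inr hv))
    rw [← simpleSwap_of_lt h, map_mul, map_mul] at this
    rw [map_mul, map_mul, map_mul, ← mul_assoc, hf, mul_assoc, polyEval_X, this,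
      MvPolynomial.rename_X, polyEval_X, mul_assoc]

theorem eq_zero_of_linearIndependent {red : Equiv.Perm (Fin n) → List ℕ}
    (hli : LinearIndependent k fun p : Equiv.Perm (Fin n) × (Fin n → ℕ) × (Fin n → I) =>
      mk Q (tauWord k (red p.1) p.2.2 * (List.ofFn fun b : Fin n => Xg k b p.2.2 ^ p.2.1 b).prod))
    (w : Equiv.Perm (Fin n)) (ν : Fin n → I) {f : MvPolynomial (Fin n) k}
    (hf : mk Q (tauWord k (red w) ν) * polyEval Q ν f = 0) : f = 0 := by
  have hli' := hli.comp (fun v : Fin n →₀ ℕ => (w, ⇑v, ν)) fun u v huv => by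
    simpa using huv
  rw [linearIndependent_iff'] at hli'
  rw [polyEval_eq_sum, Finset.mul_sum] at hf
  ext v
  by_cases hv : v ∈ f.support
  · refine hli' f.support f.coeff ?_ v hv
    rw [← hf]
    refine Finset.sum_congr rfl fun u _ => ?_
    rw [mul_smul_comm, ← map_mul]
    rfl
  · simpa using hv

theorem hermitian_of_linearIndependent (hn : 2 ≤ n) (hQdiag : ∀ i, Q i i = 0)
    {red : Equiv.Perm (Fin n) → List ℕ} (hred : ∀ w, IsReducedWordFor n (red w) w)
    (hli : LinearIndependent k fun p : Equiv.Perm (Fin n) × (Fin n → ℕ) × (Fin n → I) =>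
      mk Q (tauWord k (red p.1) p.2.2 *
        (List.ofFn fun b : Fin n => Xg k b p.2.2 ^ p.2.1 b).prod)) : Hermitian Q := by
  intro i j
  by_cases hij : i = j
  · rw [hij, hQdiag, map_zero]
  have h : 0 + 1 < n := by omega
  let ν : Fin n → I := fun a => if a.val = 0 then i else j
  have hν₀ : ν ⟨0, by omega⟩ = i := rfl
  have hν₁ : ν ⟨0 + 1, h⟩ = j := rfl
  have hμ₀ : swapSeq 0 ν ⟨0, by omega⟩ = j := by simp [swapSeq_eq, h, hν₁]
  have hμ₁ : swapSeq 0 ν ⟨0 + 1, h⟩ = i := by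
    rw [swapSeq_eq, Function.comp_apply, simpleSwap_right h, hν₀]
  have hinv : invCount (simpleSwap n 0)⁻¹ = 1 := by
    have := invCount_mul_of_lt h (g := 1) (by simp)
    simpa using this
  have hred₀ : red (simpleSwap n 0) = [0] := by
    obtain ⟨h₁, h₂, -⟩ := hred (simpleSwap n 0)
    have hlen := (hred (simpleSwap n 0)).length_eq
    rw [hinv, List.length_eq_one_iff] at hlen
    obtain ⟨a, ha⟩ := hlen
    rw [ha, permOfWord_cons, permOfWord_nil, mul_one] at h₂
    rw [ha] at h₁ ⊢
    have ha' : a + 1 < n := h₁ a (by simp)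
    have := congrArg (fun s : Equiv.Perm (Fin n) => (s ⟨0, by omega⟩).val) h₂
    simp only [simpleSwap_val ha', simpleSwap_val h] at this
    split_ifs at this with h₃ <;> simp_all
  let φ : MvPolynomial (Fin 2) k →ₐ[k] MvPolynomial (Fin n) k :=
    MvPolynomial.rename ![⟨0, by omega⟩, ⟨0 + 1, h⟩]
  have hφ : MvPolynomial.rename (simpleSwap n 0) (φ (Q j i)) =
      φ (MvPolynomial.rename (Equiv.swap (0 : Fin 2) 1) (Q j i)) := by
    simp only [φ, MvPolynomial.rename_rename]
    congr 2
    ext a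
    fin_cases a <;> simp [simpleSwap_val h]
  have e₁ := mk_rel Q (Rel.tau_sq 0 h ν)
  rw [map_mul, mk_pev Q ν _ (by omega) h, hν₀, hν₁] at e₁
  have e₂ := mk_rel Q (Rel.tau_sq 0 h (swapSeq 0 ν))
  rw [map_mul, mk_pev Q _ _ (by omega) h, hμ₀, hμ₁, swapSeq_swapSeq] at e₂
  have e₃ : mk Q (Tg k 0 h ν) * polyEval Q ν (φ (Q i j)) =
      mk Q (Tg k 0 h ν) * polyEval Q ν (MvPolynomial.rename (simpleSwap n 0) (φ (Q j i))) := by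
    have hid : ⇑(simpleSwap n 0) ∘ ⇑(simpleSwap n 0) = id := by ext a; simp
    have hrr (f : MvPolynomial (Fin n) k) :
        MvPolynomial.rename (simpleSwap n 0) (MvPolynomial.rename (simpleSwap n 0) f) = f := by
      rw [MvPolynomial.rename_rename, hid, MvPolynomial.rename_id_apply]
    rw [Tg_mul_polyEval_of_ne h (by rwa [hν₀, hν₁])
      (MvPolynomial.rename (simpleSwap n 0) (φ (Q j i))), hrr]
    calc mk Q (Tg k 0 h ν) * polyEval Q ν (φ (Q i j))
        = mk Q (Tg k 0 h ν) * (polyEval Q ν (φ (Q i j)) * mk Q (E k ν)) := by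
          rw [← mk_E_mul_polyEval, ← mul_assoc, mk_Tg_mul_E]
      _ = polyEval Q (swapSeq 0 ν) (φ (Q j i)) * mk Q (Tg k 0 h ν) := by
          rw [← e₁, ← mul_assoc, e₂, mul_assoc, mk_E_mul_Tg]
  rw [hφ] at e₃
  refine MvPolynomial.rename_injective ![(⟨0, by omega⟩ : Fin n), ⟨0 + 1, h⟩] ?_ ?_
  · intro a b hab
    fin_cases a <;> fin_cases b <;> simp_all
  · refine sub_eq_zero.1 (eq_zero_of_linearIndependent hli (simpleSwap n 0) ν ?_)
    rw [hred₀, mk_tauWord_cons Q h, tauWord, seqActWord, mk_Tg_mul_E, map_sub, mul_sub,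
      sub_eq_zero]
    exact e₃

end Algebra

section Exchange
variable {n : ℕ} {K : Type} [CommRing K]

/-- Structure constants of the action of the intertwiners on functions on the symmetric group with
values in `K`: `A p q` is the coefficient for crossing the strands `p` and `q`, `B p q` the one for
leaving them uncrossed, and `C p q` is the resulting value of the square. -/
structure ExchangeData (n : ℕ) (K : Type) [CommRing K] where
  A : Fin n → Fin n → K
  B : Fin n → Fin n → K
  C : Fin n → Fin n → K
  mul_swap : ∀ {p q}, p ≠ q → A p q * A q p = C p q - B p q ^ 2
  antisymm : ∀ {p q}, p ≠ q → B q p = -B p q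
  yang_baxter : ∀ {p q r}, p ≠ q → q ≠ r → p ≠ r → B p q * B p r + B p r * B q r = B p q * B q r

variable (D : ExchangeData n K) (k : Type) [CommRing k] [Algebra k K]

/-- The operator by which the intertwiner at the positions `i, i + 1` acts. -/
noncomputable def ExchangeData.op (i : ℕ) (h : i + 1 < n) :
    Module.End k (Equiv.Perm (Fin n) → K) :=
  Algebra.lmul k _ (fun g => D.A (g ⟨i + 1, h⟩) (g ⟨i, by omega⟩)) *
      LinearMap.funLeft k K (· * simpleSwap n i) +
    Algebra.lmul k _ (fun g => D.B (g ⟨i, by omega⟩) (g ⟨i + 1, h⟩))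

theorem ExchangeData.op_apply {i : ℕ} (h : i + 1 < n) (F : Equiv.Perm (Fin n) → K)
    (g : Equiv.Perm (Fin n)) :
    D.op k i h F g = D.A (g ⟨i + 1, h⟩) (g ⟨i, by omega⟩) * F (g * simpleSwap n i) +
      D.B (g ⟨i, by omega⟩) (g ⟨i + 1, h⟩) * F g := rfl

theorem apply_ne_apply (g : Equiv.Perm (Fin n)) {i j : ℕ} (hi : i < n) (hj : j < n)
    (hij : i ≠ j) : g ⟨i, hi⟩ ≠ g ⟨j, hj⟩ := fun e => hij (by simpa using g.injective e)

theorem ExchangeData.op_op_self {i : ℕ} (h : i + 1 < n) :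
    D.op k i h * D.op k i h =
      Algebra.lmul k _ fun g => D.C (g ⟨i, by omega⟩) (g ⟨i + 1, h⟩) := by
  refine LinearMap.ext fun F => funext fun g => ?_
  have hne := apply_ne_apply g (i := i) (j := i + 1) (by omega) h (by omega)
  simp only [Module.End.mul_apply, D.op_apply, Equiv.Perm.mul_apply, simpleSwap_left h,
    simpleSwap_right h, mul_assoc g, simpleSwap_mul_self, mul_one, Algebra.coe_lmul_eq_mul,
    LinearMap.mul_apply', Pi.mul_apply]
  linear_combination F g * D.mul_swap hne +
    D.A (g ⟨i + 1, h⟩) (g ⟨i, by omega⟩) * F (g * simpleSwap n i) * D.antisymm hne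

theorem ExchangeData.op_comm {i j : ℕ} (hi : i + 1 < n) (hj : j + 1 < n) (hij : i + 2 ≤ j) :
    D.op k i hi * D.op k j hj = D.op k j hj * D.op k i hi := by
  refine LinearMap.ext fun F => funext fun g => ?_
  have e₁ : simpleSwap n j ⟨i, by omega⟩ = ⟨i, by omega⟩ :=
    simpleSwap_of_ne (by simp; omega) (by simp; omega)
  have e₂ : simpleSwap n j ⟨i + 1, hi⟩ = ⟨i + 1, hi⟩ :=
    simpleSwap_of_ne (by simp; omega) (by simp; omega)
  have e₃ : simpleSwap n i ⟨j, by omega⟩ = ⟨j, by omega⟩ :=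
    simpleSwap_of_ne (by simp; omega) (by simp; omega)
  have e₄ : simpleSwap n i ⟨j + 1, hj⟩ = ⟨j + 1, hj⟩ :=
    simpleSwap_of_ne (by simp; omega) (by simp; omega)
  simp only [Module.End.mul_apply, D.op_apply, Equiv.Perm.mul_apply, e₁, e₂, e₃, e₄,
    mul_assoc g, simpleSwap_comm hj hij]
  ring

theorem ExchangeData.op_braid {i : ℕ} (h : i + 2 < n) :
    D.op k (i + 1) h * D.op k i (by omega) * D.op k (i + 1) h =
      D.op k i (by omega) * D.op k (i + 1) h * D.op k i (by omega) +
      Algebra.lmul k _ fun g => (D.C (g ⟨i + 1, by omega⟩) (g ⟨i + 2, h⟩) -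
        D.C (g ⟨i, by omega⟩) (g ⟨i + 1, by omega⟩)) * D.B (g ⟨i, by omega⟩) (g ⟨i + 2, h⟩) := by
  refine LinearMap.ext fun F => funext fun g => ?_
  have hi : i + 1 < n := by omega
  have e₁ : simpleSwap n (i + 1) ⟨i, by omega⟩ = ⟨i, by omega⟩ :=
    simpleSwap_of_ne (by simp) (by simp; omega)
  have e₂ : simpleSwap n i ⟨i + 2, h⟩ = ⟨i + 2, h⟩ :=
    simpleSwap_of_ne (by simp) (by simp)
  have e₃ : simpleSwap n (i + 1) ⟨i + 2, h⟩ = ⟨i + 1, hi⟩ := simpleSwap_right h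
  have e₄ : simpleSwap n (i + 1) ⟨i + 1, hi⟩ = ⟨i + 2, h⟩ := simpleSwap_left h
  have h₁ := apply_ne_apply g (i := i) (j := i + 1) (by omega) hi (by omega)
  have h₂ := apply_ne_apply g (i := i + 1) (j := i + 2) hi h (by omega)
  have h₃ := apply_ne_apply g (i := i) (j := i + 2) (by omega) h (by omega)
  simp only [LinearMap.add_apply, Pi.add_apply, Module.End.mul_apply, D.op_apply,
    Equiv.Perm.mul_apply, simpleSwap_left hi, simpleSwap_right hi, e₁, e₂, e₃, e₄, mul_assoc g,
    simpleSwap_braid h, simpleSwap_mul_self, mul_one, Algebra.coe_lmul_eq_mul,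
    LinearMap.mul_apply', Pi.mul_apply, show i + 1 + 1 = i + 2 from rfl]
  generalize g ⟨i, _⟩ = p at *
  generalize g ⟨i + 1, _⟩ = q at *
  generalize g ⟨i + 2, _⟩ = r at *
  have yb := D.yang_baxter h₁ h₂ h₃
  have m₁ := D.mul_swap h₁
  have m₂ := D.mul_swap h₂
  rw [D.antisymm h₁, D.antisymm h₂]
  linear_combination (F g * D.B p r) * m₂ - (F g * D.B p r) * m₁ +
    (F g * (D.B p q - D.B q r) - F (g * simpleSwap n (i + 1)) * D.A r q +
      F (g * simpleSwap n i) * D.A q p) * yb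

end Exchange

section Representation
variable {k : Type} [CommRing k] {I : Type} {n : ℕ} {Q : I → I → MvPolynomial (Fin 2) k}
  {K : Type} [CommRing K] [Algebra k K]

theorem Hermitian.aeval_comm (hQ : Hermitian Q) (i j : I) (a b : K) :
    MvPolynomial.aeval ![a, b] (Q i j) = MvPolynomial.aeval ![b, a] (Q j i) := by
  rw [hQ i j, MvPolynomial.aeval_rename]
  congr 2
  ext c
  fin_cases c <;> simp

theorem ringInverse_sub_comm {a b : K} (h : IsUnit (a - b)) :
    Ring.inverse (b - a) = -Ring.inverse (a - b) := by
  obtain ⟨u, hu⟩ := h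
  rw [← neg_sub, ← hu, ← Units.val_neg, Ring.inverse_unit, Ring.inverse_unit, inv_neg,
    Units.val_neg]

open Classical in
/-- The exchange data attached to strands coloured by `ν` with spectral parameters `y`. -/
noncomputable def coloredData (hQ : Hermitian Q) (hQdiag : ∀ i, Q i i = 0) (ν : Fin n → I)
    {y : Fin n → K} (hy : ∀ p q, p ≠ q → IsUnit (y p - y q)) : ExchangeData n K where
  A p q := if ν p = ν q then Ring.inverse (y p - y q) else
    if p < q then 1 else MvPolynomial.aeval ![y p, y q] (Q (ν p) (ν q))
  B p q := if ν p = ν q then -Ring.inverse (y p - y q) else 0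
  C p q := MvPolynomial.aeval ![y p, y q] (Q (ν p) (ν q))
  mul_swap {p q} hpq := by
    by_cases h : ν p = ν q
    · rw [if_pos h, if_pos h.symm, if_pos h, h, hQdiag, map_zero, ringInverse_sub_comm (hy p q hpq)]
      ring
    · rw [if_neg h, if_neg (Ne.symm h), if_neg h]
      rcases lt_or_gt_of_ne hpq with hlt | hlt
      · rw [if_pos hlt, if_neg hlt.not_gt, hQ.aeval_comm]
        ring
      · rw [if_pos hlt, if_neg hlt.not_gt]
        ring
  antisymm {p q} hpq := by
    by_cases h : ν p = ν q
    · rw [if_pos h, if_pos h.symm, ringInverse_sub_comm (hy p q hpq)]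
    · rw [if_neg h, if_neg (Ne.symm h), neg_zero]
  yang_baxter {p q r} hpq hqr hpr := by
    by_cases h₁ : ν p = ν q
    · by_cases h₂ : ν q = ν r
      · simp only [if_pos h₁, if_pos h₂, if_pos (h₁.trans h₂)]
        have e₁ := Ring.inverse_mul_cancel _ (hy p q hpq)
        have e₂ := Ring.inverse_mul_cancel _ (hy q r hqr)
        have e₃ := Ring.inverse_mul_cancel _ (hy p r hpr)
        generalize Ring.inverse (y p - y q) = a at *
        generalize Ring.inverse (y q - y r) = b at *
        generalize Ring.inverse (y p - y r) = c at *
        linear_combination (-a * c) * e₂ - (c * b) * e₁ + (a * b) * e₃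
      · have h₃ : ν p ≠ ν r := fun e => h₂ (h₁.symm.trans e)
        simp [h₂, h₃]
    · by_cases h₂ : ν q = ν r
      · have h₃ : ν p ≠ ν r := fun e => h₁ (e.trans h₂.symm)
        simp [h₁, h₃]
      · simp [h₁, h₂]

variable (hQ : Hermitian Q) (hQdiag : ∀ i, Q i i = 0) (ν : Fin n → I)
    {y : Fin n → K} (hy : ∀ p q, p ≠ q → IsUnit (y p - y q))

theorem coloredData_B_of_ne {p q : Fin n} (h : ν p ≠ ν q) :
    (coloredData hQ hQdiag ν hy).B p q = 0 := if_neg h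

theorem coloredData_B_mul {p q : Fin n} (hpq : p ≠ q) (h : ν p = ν q) :
    (coloredData hQ hQdiag ν hy).B p q * (y p - y q) = -1 := by
  simp only [coloredData, if_pos h]
  rw [neg_mul, Ring.inverse_mul_cancel _ (hy p q hpq)]

theorem coloredData_C (p q : Fin n) : (coloredData hQ hQdiag ν hy).C p q =
    MvPolynomial.aeval ![y p, y q] (Q (ν p) (ν q)) := rfl

theorem isUnit_coloredData_A {p q : Fin n} (hpq : p < q) :
    IsUnit ((coloredData hQ hQdiag ν hy).A p q) := by
  simp only [coloredData]
  split_ifs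
  · exact (hy p q hpq.ne).ringInverse
  · exact isUnit_one

open Classical in
/-- The indicator function of the orderings of the strands with colour sequence `μ`. -/
noncomputable def colorIndicator (K : Type) [CommRing K] (ν μ : Fin n → I) :
    Equiv.Perm (Fin n) → K := fun g => if ν ∘ g = μ then 1 else 0

theorem colorIndicator_mul_self (ν μ : Fin n → I) :
    colorIndicator K ν μ * colorIndicator K ν μ = colorIndicator K ν μ := by
  ext g
  by_cases e : ν ∘ g = μ <;> simp [colorIndicator, e]

theorem colorIndicator_mul_of_ne (ν : Fin n → I) {μ μ' : Fin n → I} (h : μ ≠ μ') :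
    colorIndicator K ν μ * colorIndicator K ν μ' = 0 := by
  ext g
  by_cases e : ν ∘ g = μ
  · simp [colorIndicator, e, h]
  · simp [colorIndicator, e]

theorem colorIndicator_swap (ν μ : Fin n → I) (g : Equiv.Perm (Fin n)) (i : ℕ) :
    colorIndicator K ν μ (g * simpleSwap n i) = colorIndicator K ν (swapSeq i μ) g := by
  simp only [colorIndicator]
  congr 1
  rw [swapSeq_eq, eq_iff_iff]
  constructor
  · rintro rfl; ext a; simp
  · intro e
    ext a
    have := congrFun e (simpleSwap n i a)
    simpa using this

theorem op_mul_indicator {i : ℕ} (h : i + 1 < n) (μ : Fin n → I) :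
    (coloredData hQ hQdiag ν hy).op k i h *
        Algebra.lmul k (Equiv.Perm (Fin n) → K) (colorIndicator K ν μ) =
      Algebra.lmul k (Equiv.Perm (Fin n) → K) (colorIndicator K ν (swapSeq i μ)) *
        (coloredData hQ hQdiag ν hy).op k i h := by
  refine LinearMap.ext fun F => funext fun g => ?_
  simp only [Module.End.mul_apply, ExchangeData.op_apply, Algebra.coe_lmul_eq_mul,
    LinearMap.mul_apply', Pi.mul_apply, colorIndicator_swap]
  by_cases hv : ν (g ⟨i, by omega⟩) = ν (g ⟨i + 1, h⟩)
  · have : colorIndicator K ν (swapSeq i μ) g = colorIndicator K ν μ g := by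
      rw [← colorIndicator_swap]
      simp only [colorIndicator]
      congr 2
      ext a
      by_cases h₁ : a.val = i
      · rw [show a = ⟨i, by omega⟩ from Fin.ext h₁]; simp [h, hv]
      by_cases h₂ : a.val = i + 1
      · rw [show a = ⟨i + 1, h⟩ from Fin.ext h₂]; simp [hv]
      simp [simpleSwap_of_ne h₁ h₂]
    rw [this]; ring
  · rw [coloredData_B_of_ne _ _ _ _ hv]; ring

/-- The action of the free algebra on functions on the orderings of the strands. -/
noncomputable def freeRep : FA k I n →ₐ[k] Module.End k (Equiv.Perm (Fin n) → K) :=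
  FreeAlgebra.lift k fun x : Gen I n => match x with
    | .unit μ => Algebra.lmul k (Equiv.Perm (Fin n) → K) (colorIndicator K ν μ)
    | .x a μ => Algebra.lmul k (Equiv.Perm (Fin n) → K)
        ((fun g : Equiv.Perm (Fin n) => y (g a)) * colorIndicator K ν μ)
    | .tau i h μ => (coloredData hQ hQdiag ν hy).op k i h *
        Algebra.lmul k (Equiv.Perm (Fin n) → K) (colorIndicator K ν μ)

theorem freeRep_E (μ : Fin n → I) : freeRep hQ hQdiag ν hy (E k μ) =
    Algebra.lmul k (Equiv.Perm (Fin n) → K) (colorIndicator K ν μ) := by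
  simp [freeRep, E]

theorem freeRep_Xg (a : Fin n) (μ : Fin n → I) : freeRep hQ hQdiag ν hy (Xg k a μ) =
    Algebra.lmul k (Equiv.Perm (Fin n) → K)
      ((fun g : Equiv.Perm (Fin n) => y (g a)) * colorIndicator K ν μ) := by
  simp [freeRep, Xg]

theorem freeRep_Tg (i : ℕ) (h : i + 1 < n) (μ : Fin n → I) :
    freeRep hQ hQdiag ν hy (Tg k i h μ) = (coloredData hQ hQdiag ν hy).op k i h *
      Algebra.lmul k (Equiv.Perm (Fin n) → K) (colorIndicator K ν μ) := by
  simp [freeRep, Tg]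

theorem freeRep_pev (P : MvPolynomial (Fin 2) k) (a b : ℕ) (ha : a < n) (hb : b < n)
    (μ : Fin n → I) :
    freeRep hQ hQdiag ν hy (pev P (Xn k a μ) (Xn k b μ) (E k μ)) =
      Algebra.lmul k (Equiv.Perm (Fin n) → K) ((fun g : Equiv.Perm (Fin n) =>
        MvPolynomial.aeval ![y (g ⟨a, ha⟩), y (g ⟨b, hb⟩)] P) * colorIndicator K ν μ) := by
  simp only [pev, map_sum, map_smul, map_mul, map_pow, Xn_of_lt ha, Xn_of_lt hb, freeRep_E,
    freeRep_Xg]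
  simp only [← map_mul, ← map_pow, ← map_smul, ← map_sum]
  congr 1
  ext g
  by_cases e : ν ∘ g = μ
  · simp [colorIndicator, e, MvPolynomial.aeval_def, MvPolynomial.eval₂_eq', Algebra.smul_def,
      Fin.prod_univ_two]
  · simp [colorIndicator, e]

theorem freeRep_pevDiff (P : MvPolynomial (Fin 2) k) (a b c : ℕ) (ha : a < n) (hb : b < n)
    (hc : c < n) (μ : Fin n → I) :
    ∃ D : Equiv.Perm (Fin n) → K,
      freeRep hQ hQdiag ν hy (pevDiff P (Xn k a μ) (Xn k b μ) (Xn k c μ) (E k μ)) =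
        Algebra.lmul k (Equiv.Perm (Fin n) → K) (D * colorIndicator K ν μ) ∧
      ∀ g, D g * (y (g ⟨c, hc⟩) - y (g ⟨a, ha⟩)) =
        MvPolynomial.aeval ![y (g ⟨c, hc⟩), y (g ⟨b, hb⟩)] P -
          MvPolynomial.aeval ![y (g ⟨a, ha⟩), y (g ⟨b, hb⟩)] P := by
  refine ⟨fun g => ∑ m ∈ P.support, P.coeff m •
    ((∑ t ∈ Finset.range (m 0), y (g ⟨c, hc⟩) ^ t * y (g ⟨a, ha⟩) ^ (m 0 - 1 - t)) *
      y (g ⟨b, hb⟩) ^ m 1), ?_, fun g => ?_⟩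
  · simp only [pevDiff, map_sum, map_smul, map_mul, map_pow, Xn_of_lt ha, Xn_of_lt hb,
      Xn_of_lt hc, freeRep_E, freeRep_Xg]
    simp only [← map_mul, ← map_pow, ← map_smul, ← map_sum]
    congr 1
    ext g
    by_cases e : ν ∘ g = μ
    · simp [colorIndicator, e]
    · simp [colorIndicator, e]
  · simp only [MvPolynomial.aeval_def, MvPolynomial.eval₂_eq', Fin.prod_univ_two]
    rw [Finset.sum_mul, ← Finset.sum_sub_distrib]
    refine Finset.sum_congr rfl fun m _ => ?_
    rw [Algebra.smul_def]
    have := geom_sum₂_mul (y (g ⟨c, hc⟩)) (y (g ⟨a, ha⟩)) (m 0)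
    simp only [Matrix.cons_val_zero, Matrix.cons_val_one]
    linear_combination (algebraMap k K (P.coeff m) * y (g ⟨b, hb⟩) ^ m 1) * this

theorem lmul_indicator_mul_self (μ : Fin n → I) :
    Algebra.lmul k (Equiv.Perm (Fin n) → K) (colorIndicator K ν μ) *
      Algebra.lmul k (Equiv.Perm (Fin n) → K) (colorIndicator K ν μ) =
    Algebra.lmul k (Equiv.Perm (Fin n) → K) (colorIndicator K ν μ) := by
  rw [← map_mul, colorIndicator_mul_self]

theorem mul_indicator_mul_op_mul_indicator (Φ : Module.End k (Equiv.Perm (Fin n) → K)) {j : ℕ}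
    (h : j + 1 < n) (μ : Fin n → I) :
    (Φ * Algebra.lmul k (Equiv.Perm (Fin n) → K) (colorIndicator K ν (swapSeq j μ))) *
      ((coloredData hQ hQdiag ν hy).op k j h *
        Algebra.lmul k (Equiv.Perm (Fin n) → K) (colorIndicator K ν μ)) =
    Φ * (coloredData hQ hQdiag ν hy).op k j h *
      Algebra.lmul k (Equiv.Perm (Fin n) → K) (colorIndicator K ν μ) := by
  rw [mul_assoc, ← mul_assoc _ _ (Algebra.lmul k _ (colorIndicator K ν μ)), ← op_mul_indicator,
    mul_assoc _ _ (Algebra.lmul k _ (colorIndicator K ν μ)), lmul_indicator_mul_self, ← mul_assoc]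

theorem lmul_mul_indicator_congr {f f' : Equiv.Perm (Fin n) → K} {μ : Fin n → I}
    (h : ∀ g : Equiv.Perm (Fin n), ν ∘ g = μ → f g = f' g) :
    Algebra.lmul k (Equiv.Perm (Fin n) → K) f *
      Algebra.lmul k (Equiv.Perm (Fin n) → K) (colorIndicator K ν μ) =
    Algebra.lmul k (Equiv.Perm (Fin n) → K) (f' * colorIndicator K ν μ) := by
  rw [← map_mul]
  congr 1
  ext g
  by_cases e : ν ∘ g = μ
  · simp [h g e]
  · simp [colorIndicator, e]

theorem swapSeq_eq_self {i : ℕ} (h : i + 1 < n) {μ : Fin n → I}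
    (hμ : μ ⟨i, by omega⟩ = μ ⟨i + 1, h⟩) : swapSeq i μ = μ := by
  ext a
  rw [swapSeq_eq, Function.comp_apply]
  by_cases h₁ : a.val = i
  · rw [show a = ⟨i, by omega⟩ from Fin.ext h₁, simpleSwap_left h, hμ]
  by_cases h₂ : a.val = i + 1
  · rw [show a = ⟨i + 1, h⟩ from Fin.ext h₂, simpleSwap_right h, hμ]
  rw [simpleSwap_of_ne h₁ h₂]

theorem freeRep_rel {a b : FA k I n} (h : Rel Q a b) :
    freeRep hQ hQdiag ν hy a = freeRep hQ hQdiag ν hy b := by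
  induction h with
  | unit_mul_self μ => rw [map_mul, freeRep_E, lmul_indicator_mul_self]
  | unit_mul_ne μ μ' h =>
    rw [map_mul, freeRep_E, freeRep_E, ← map_mul, colorIndicator_mul_of_ne ν h, map_zero, map_zero]
  | tau_sandwich i h μ =>
    rw [map_mul, map_mul, freeRep_E, freeRep_E, freeRep_Tg, mul_assoc, mul_assoc,
      lmul_indicator_mul_self, ← mul_assoc, ← op_mul_indicator, mul_assoc, lmul_indicator_mul_self]
  | x_sandwich a μ =>
    rw [map_mul, map_mul, freeRep_E, freeRep_Xg, ← map_mul, ← map_mul]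
    congr 1
    rw [mul_assoc, mul_assoc, colorIndicator_mul_self, mul_left_comm, colorIndicator_mul_self]
  | x_comm a b μ =>
    rw [map_mul, map_mul, freeRep_Xg, freeRep_Xg, ← map_mul, ← map_mul, mul_comm]
  | tau_sq i h μ =>
    rw [map_mul, freeRep_Tg, freeRep_Tg, mul_indicator_mul_op_mul_indicator,
      ExchangeData.op_op_self, freeRep_pev hQ hQdiag ν hy _ _ _ (by omega) h]
    refine lmul_mul_indicator_congr ν fun g hg => ?_
    rw [coloredData_C, ← hg]
    rfl
  | tau_far i j hi hj hij μ =>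
    rw [map_mul, map_mul, freeRep_Tg, freeRep_Tg, freeRep_Tg, freeRep_Tg,
      mul_indicator_mul_op_mul_indicator, mul_indicator_mul_op_mul_indicator,
      ExchangeData.op_comm _ k hi hj hij]
  | braid_eq i h μ hv =>
    obtain ⟨D, hD, hD'⟩ := freeRep_pevDiff hQ hQdiag ν hy
      (Q (μ ⟨i, by omega⟩) (μ ⟨i + 1, by omega⟩)) i (i + 1) (i + 2) (by omega) (by omega) h μ
    simp only [map_add, map_mul, freeRep_Tg, mul_indicator_mul_op_mul_indicator, hD]
    rw [ExchangeData.op_braid _ k h, add_mul, lmul_mul_indicator_congr (f' := D), map_mul]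
    rintro g rfl
    have hne := apply_ne_apply g (i := i) (j := i + 2) (by omega) h (by omega)
    have hB := coloredData_B_mul hQ hQdiag ν hy hne hv
    have := hD' g
    simp only [Function.comp_apply] at hv this
    simp only [coloredData_C]
    rw [hQ.aeval_comm (ν (g ⟨i + 1, _⟩)), ← hv]
    linear_combination (-D g) * hB -
      (coloredData hQ hQdiag ν hy).B (g ⟨i, by omega⟩) (g ⟨i + 2, h⟩) * this
  | braid_ne i h μ hv =>
    simp only [map_mul, freeRep_Tg, mul_indicator_mul_op_mul_indicator]
    rw [ExchangeData.op_braid _ k h, add_mul]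
    rw [lmul_mul_indicator_congr (f' := 0), zero_mul, map_zero, add_zero]
    rintro g rfl
    exact mul_eq_zero_of_right _ (coloredData_B_of_ne hQ hQdiag ν hy hv)
  | tau_x_i i h μ hv =>
    rw [Xn_of_lt (by omega), Xn_of_lt h, map_mul, map_sub, map_mul, freeRep_Tg, freeRep_Xg,
      freeRep_Xg, freeRep_E, swapSeq_eq_self h hv]
    refine LinearMap.ext fun F => funext fun g => ?_
    have hB := coloredData_B_mul hQ hQdiag ν hy (apply_ne_apply g (i := i) (j := i + 1)
      (by omega) h (by omega))
    simp only [LinearMap.sub_apply, Pi.sub_apply, Module.End.mul_apply, ExchangeData.op_apply,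
      Algebra.coe_lmul_eq_mul, LinearMap.mul_apply', Pi.mul_apply, colorIndicator_swap,
      swapSeq_eq_self h hv, Equiv.Perm.mul_apply, simpleSwap_left h]
    by_cases e : ν ∘ g = μ
    · subst e
      simp only [colorIndicator, if_true]
      linear_combination F g * hB hv
    · simp [colorIndicator, e]
  | tau_x_i1 i h μ hv =>
    rw [Xn_of_lt h, Xn_of_lt (by omega), map_mul, map_add, map_mul, freeRep_Tg, freeRep_Xg,
      freeRep_Xg, freeRep_E, swapSeq_eq_self h hv]
    refine LinearMap.ext fun F => funext fun g => ?_
    have hB := coloredData_B_mul hQ hQdiag ν hy (apply_ne_apply g (i := i) (j := i + 1)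
      (by omega) h (by omega))
    simp only [LinearMap.add_apply, Pi.add_apply, Module.End.mul_apply, ExchangeData.op_apply,
      Algebra.coe_lmul_eq_mul, LinearMap.mul_apply', Pi.mul_apply, colorIndicator_swap,
      swapSeq_eq_self h hv, Equiv.Perm.mul_apply, simpleSwap_right h]
    by_cases e : ν ∘ g = μ
    · subst e
      simp only [colorIndicator, if_true]
      linear_combination -F g * hB hv
    · simp [colorIndicator, e]
  | tau_x_other i h a μ hv =>
    rw [← simpleSwap_of_lt h, map_mul, map_mul, freeRep_Tg, freeRep_Xg, freeRep_Xg]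
    refine LinearMap.ext fun F => funext fun g => ?_
    simp only [Module.End.mul_apply, ExchangeData.op_apply, Algebra.coe_lmul_eq_mul,
      LinearMap.mul_apply', Pi.mul_apply, colorIndicator_swap, Equiv.Perm.mul_apply]
    by_cases hμ : μ ⟨i, by omega⟩ = μ ⟨i + 1, h⟩
    · obtain ⟨h₁, h₂⟩ := hv.resolve_right (not_not.2 hμ)
      rw [swapSeq_eq_self h hμ, simpleSwap_of_ne h₁ h₂]
      by_cases e : ν ∘ g = μ
      · simp only [colorIndicator, if_pos e]
        ring
      · simp [colorIndicator, e]
    · by_cases e : ν ∘ g = μ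
      · subst e
        rw [coloredData_B_of_ne hQ hQdiag ν hy hμ]
        by_cases e' : ν ∘ g = swapSeq i (ν ∘ g)
        · simp only [colorIndicator, if_pos e']
          ring
        · simp [colorIndicator, e']
      · by_cases e' : ν ∘ g = swapSeq i μ
        · simp only [colorIndicator, if_pos e', if_neg e]
          ring
        · simp [e, e', colorIndicator]

/-- The action of `H_n(Q)` on functions on the orderings of the strands. -/
noncomputable def rep : HQ k I n Q →ₐ[k] Module.End k (Equiv.Perm (Fin n) → K) :=
  RingQuot.liftAlgHom k ⟨freeRep hQ hQdiag ν hy, fun _ _ => freeRep_rel hQ hQdiag ν hy⟩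

theorem rep_mk (a : FA k I n) :
    rep hQ hQdiag ν hy (mk Q a) = freeRep hQ hQdiag ν hy a := by
  rw [rep, mk, RingQuot.liftAlgHom_mkAlgHom_apply]

theorem rep_polyEval_single (f : MvPolynomial (Fin n) k) :
    rep hQ hQdiag ν hy (polyEval Q ν f) (Pi.single 1 1) =
      Pi.single 1 (MvPolynomial.aeval y f) := by
  induction f using MvPolynomial.induction_on with
  | C c =>
    rw [MvPolynomial.C_eq_algebraMap, AlgHom.commutes, AlgHom.commutes, AlgHom.commutes,
      Module.algebraMap_end_apply, ← Pi.single_smul', Algebra.smul_def, mul_one]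
  | add f g hf hg => simp only [map_add, LinearMap.add_apply, hf, hg, Pi.single_add]
  | mul_X f a hf =>
    rw [mul_comm, map_mul, map_mul, Module.End.mul_apply, hf, polyEval_X, rep_mk, freeRep_Xg]
    ext g
    by_cases hg : g = 1
    · subst hg; simp [colorIndicator]
    · simp [hg]

theorem rep_E_single_of_ne {μ : Fin n → I} (h : μ ≠ ν) :
    rep hQ hQdiag ν hy (mk Q (E k μ)) (Pi.single 1 1) = 0 := by
  rw [rep_mk, freeRep_E]
  ext g
  by_cases hg : g = 1
  · subst hg; simp [colorIndicator, h.symm]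
  · simp [hg]

theorem rep_tauWord_single {l : List ℕ} (hl : ∀ i ∈ l, i + 1 < n) :
    (∀ (c : K) (g : Equiv.Perm (Fin n)), l.length ≤ invCount g → g ≠ (permOfWord n l)⁻¹ →
      rep hQ hQdiag ν hy (mk Q (tauWord k l ν)) (Pi.single 1 c) g = 0) ∧
    (invCount (permOfWord n l)⁻¹ = l.length → ∃ u : K, IsUnit u ∧ ∀ c : K,
      rep hQ hQdiag ν hy (mk Q (tauWord k l ν)) (Pi.single 1 c) (permOfWord n l)⁻¹ = u * c) := by
  induction l with
  | nil =>
    have hE (c : K) : rep hQ hQdiag ν hy (mk Q (tauWord k [] ν)) (Pi.single 1 c) =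
        Pi.single 1 c := by
      rw [tauWord, rep_mk, freeRep_E]
      ext g
      by_cases hg : g = 1
      · subst hg; simp [colorIndicator]
      · simp [hg]
    simp only [hE, permOfWord_nil, inv_one]
    exact ⟨fun c g _ hg => by simp [hg], fun _ => ⟨1, isUnit_one, fun c => by simp⟩⟩
  | cons i l ih =>
    have h := hl i (by simp)
    have hl' : ∀ j ∈ l, j + 1 < n := fun j hj => hl j (by simp [hj])
    obtain ⟨ih₁, ih₂⟩ := ih hl'
    have hlen := invCount_le_length hl'
    have hT : rep hQ hQdiag ν hy (mk Q (tauWord k (i :: l) ν)) =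
        (coloredData hQ hQdiag ν hy).op k i h * rep hQ hQdiag ν hy (mk Q (tauWord k l ν)) := by
      rw [mk_tauWord_cons Q h, map_mul, rep_mk hQ hQdiag ν hy (Tg k i h _), freeRep_Tg,
        ← freeRep_E hQ hQdiag ν hy, ← rep_mk, mul_assoc, ← map_mul, mk_E_mul_tauWord Q hl']
    have hzero (c : K) {g : Equiv.Perm (Fin n)} (hg : l.length + 1 ≤ invCount g) :
        rep hQ hQdiag ν hy (mk Q (tauWord k l ν)) (Pi.single 1 c) g = 0 := by
      refine ih₁ c g (by omega) ?_
      rintro rfl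
      omega
    rw [permOfWord_cons_inv, List.length_cons]
    refine ⟨fun c g hg hne => ?_, fun hinv => ?_⟩
    · have hle := invCount_mul_le h (g * simpleSwap n i)
      rw [mul_assoc, simpleSwap_mul_self, mul_one] at hle
      rw [hT, Module.End.mul_apply, ExchangeData.op_apply, hzero c hg,
        ih₁ c (g * simpleSwap n i) (by omega) fun e => hne ?_, mul_zero, mul_zero, add_zero]
      rw [← e, mul_assoc, simpleSwap_mul_self, mul_one]
    · have hle := invCount_mul_le h (permOfWord n l)⁻¹
      obtain ⟨u, hu, hu'⟩ := ih₂ (by omega)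
      have hlt : (permOfWord n l)⁻¹ ⟨i, by omega⟩ < (permOfWord n l)⁻¹ ⟨i + 1, h⟩ := by
        refine (lt_or_gt_of_succ h _).resolve_right fun hgt => ?_
        have := invCount_mul_of_gt h hgt
        omega
      refine ⟨_, (isUnit_coloredData_A hQ hQdiag ν hy hlt).mul hu, fun c => ?_⟩
      rw [hT, Module.End.mul_apply, ExchangeData.op_apply, hzero c hinv.ge, mul_zero, add_zero,
        mul_assoc _ (simpleSwap n i), simpleSwap_mul_self, mul_one, hu', Equiv.Perm.mul_apply,
        Equiv.Perm.mul_apply, simpleSwap_left h, simpleSwap_right h, mul_assoc]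

theorem isRegular_X_sub_X {p q : Fin n} (hpq : p ≠ q) :
    IsRegular (MvPolynomial.X p - MvPolynomial.X q : MvPolynomial (Fin n) k) := by
  classical
  let σ : MvPolynomial (Fin n) k →ₐ[k] MvPolynomial (Fin n) k := MvPolynomial.aeval
    fun a => if a = p then MvPolynomial.X p + MvPolynomial.X q else MvPolynomial.X a
  let σ' : MvPolynomial (Fin n) k →ₐ[k] MvPolynomial (Fin n) k := MvPolynomial.aeval
    fun a => if a = p then MvPolynomial.X p - MvPolynomial.X q else MvPolynomial.X a
  have hσ : σ'.comp σ = AlgHom.id k _ := by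
    ext1 a
    by_cases ha : a = p
    · simp [σ, σ', ha, hpq.symm]
    · simp [σ, σ', ha]
  have hinj : Function.Injective σ := Function.LeftInverse.injective (g := σ') fun f =>
    DFunLike.congr_fun hσ f
  have hX : σ (MvPolynomial.X p - MvPolynomial.X q) = MvPolynomial.X p := by
    simp [σ, hpq.symm]
  rw [← isLeftRegular_iff_isRegular]
  intro a b hab
  apply hinj
  have := congrArg σ hab
  simp only [map_mul, hX] at this
  exact (MvPolynomial.isRegular_X (R := k) (n := p)).left this

theorem rep_standard_single (l : List ℕ) (a : Fin n → ℕ) :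
    rep hQ hQdiag ν hy (mk Q (tauWord k l ν * (List.ofFn fun b : Fin n => Xg k b ν ^ a b).prod))
      (Pi.single 1 1) =
    rep hQ hQdiag ν hy (mk Q (tauWord k l ν)) (Pi.single 1 (MvPolynomial.aeval y
      (MvPolynomial.monomial (Finsupp.equivFunOnFinite.symm a) 1 : MvPolynomial (Fin n) k))) := by
  rw [map_mul, mk_prod_ofFn, map_mul, Module.End.mul_apply, rep_polyEval_single]

theorem rep_standard_single_of_ne (l : List ℕ) (a : Fin n → ℕ) {μ : Fin n → I} (h : μ ≠ ν) :
    rep hQ hQdiag ν hy (mk Q (tauWord k l μ * (List.ofFn fun b : Fin n => Xg k b μ ^ a b).prod))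
      (Pi.single 1 1) = 0 := by
  rw [map_mul, mk_prod_ofFn, ← mk_tauWord_mul_E, mul_assoc, mk_E_mul_polyEval, map_mul, map_mul,
    Module.End.mul_apply, Module.End.mul_apply, rep_E_single_of_ne hQ hQdiag ν hy h, map_zero,
    map_zero]

theorem linearIndependent_of_aeval_injective (hQ : Hermitian Q) (hQdiag : ∀ i, Q i i = 0)
    (hy : ∀ p q, p ≠ q → IsUnit (y p - y q))
    (hinj : Function.Injective (MvPolynomial.aeval y : MvPolynomial (Fin n) k →ₐ[k] K))
    {red : Equiv.Perm (Fin n) → List ℕ} (hred : ∀ w, IsReducedWordFor n (red w) w) :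
    LinearIndependent k fun p : Equiv.Perm (Fin n) × (Fin n → ℕ) × (Fin n → I) =>
      mk Q (tauWord k (red p.1) p.2.2 *
        (List.ofFn fun b : Fin n => Xg k b p.2.2 ^ p.2.1 b).prod) := by
  classical
  rw [linearIndependent_iff']
  intro s c hsum
  by_contra! hne
  have hs : (s.filter fun p => c p ≠ 0).Nonempty := by
    obtain ⟨p, hp, hcp⟩ := hne
    exact ⟨p, by simp [hp, hcp]⟩
  obtain ⟨⟨w, a, ν⟩, hmem, hmax⟩ :=
    (s.filter fun p => c p ≠ 0).exists_max_image (fun p => invCount p.1⁻¹) hs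
  rw [Finset.mem_filter] at hmem
  refine hmem.2 ?_
  obtain ⟨hw, hwperm, -⟩ := hred w
  have hwlen := (hred w).length_eq
  obtain ⟨u, hu, hu'⟩ := (rep_tauWord_single hQ hQdiag ν hy hw).2 (by rw [hwperm, hwlen])
  rw [hwperm] at hu'
  have hterm (p : Equiv.Perm (Fin n) × (Fin n → ℕ) × (Fin n → I)) (hp : p ∈ s) :
      rep hQ hQdiag ν hy (c p • mk Q (tauWord k (red p.1) p.2.2 *
        (List.ofFn fun b : Fin n => Xg k b p.2.2 ^ p.2.1 b).prod)) (Pi.single 1 1) w⁻¹ =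
      u * MvPolynomial.aeval y (if p.1 = w ∧ p.2.2 = ν then
        MvPolynomial.monomial (Finsupp.equivFunOnFinite.symm p.2.1) (c p) else 0) := by
    obtain ⟨w', a', ν'⟩ := p
    by_cases hc : c (w', a', ν') = 0
    · simp [hc]
    have hle : invCount w'⁻¹ ≤ invCount w⁻¹ :=
      hmax (w', a', ν') (Finset.mem_filter.2 ⟨hp, hc⟩)
    obtain ⟨hw', hwperm', -⟩ := hred w'
    have hwlen' := (hred w').length_eq
    rw [map_smul, LinearMap.smul_apply, Pi.smul_apply]
    by_cases hν : ν' = ν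
    · subst hν
      rw [rep_standard_single]
      by_cases hww : w' = w
      · subst hww
        rw [hu', if_pos ⟨rfl, rfl⟩, ← mul_smul_comm, ← map_smul, MvPolynomial.smul_monomial,
          smul_eq_mul, mul_one]
      · rw [(rep_tauWord_single hQ hQdiag ν' hy hw').1 _ _ (by omega), if_neg (by simp [hww]),
          map_zero, mul_zero, smul_zero]
        rw [hwperm']
        exact fun e => hww (inv_injective e).symm
    · rw [rep_standard_single_of_ne hQ hQdiag ν hy _ _ hν, if_neg (by simp [hν]), map_zero,
        mul_zero, Pi.zero_apply, smul_zero]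
  have hzero := congrArg (fun z => rep hQ hQdiag ν hy z (Pi.single 1 1) w⁻¹) hsum
  simp only [map_sum, LinearMap.sum_apply, Finset.sum_apply] at hzero
  rw [Finset.sum_congr rfl hterm, ← Finset.mul_sum, ← map_sum, map_zero, LinearMap.zero_apply,
    Pi.zero_apply, hu.mul_right_eq_zero, map_eq_zero_iff _ hinj] at hzero
  have hcoeff := congrArg (MvPolynomial.coeff (Finsupp.equivFunOnFinite.symm a)) hzero
  rw [MvPolynomial.coeff_sum, Finset.sum_eq_single (w, a, ν)] at hcoeff
  · simpa using hcoeff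
  · rintro ⟨w', a', ν'⟩ - hp
    dsimp only
    split_ifs with h
    · obtain ⟨rfl, rfl⟩ := h
      rw [MvPolynomial.coeff_monomial, if_neg]
      simpa using hp
    · simp
  · exact fun h => absurd hmem.1 h

theorem linearIndependent_of_hermitian (hQ : Hermitian Q) (hQdiag : ∀ i, Q i i = 0)
    {red : Equiv.Perm (Fin n) → List ℕ} (hred : ∀ w, IsReducedWordFor n (red w) w) :
    LinearIndependent k fun p : Equiv.Perm (Fin n) × (Fin n → ℕ) × (Fin n → I) =>
      mk Q (tauWord k (red p.1) p.2.2 *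
        (List.ofFn fun b : Fin n => Xg k b p.2.2 ^ p.2.1 b).prod) := by
  refine linearIndependent_of_aeval_injective (K := FractionRing (MvPolynomial (Fin n) k))
    (y := fun a => algebraMap (MvPolynomial (Fin n) k) _ (MvPolynomial.X a))
    hQ hQdiag (fun p q hpq => ?_) ?_ hred
  · rw [← map_sub]
    exact IsLocalization.map_units _ (⟨_, (isRegular_X_sub_X hpq).mem_nonZeroDivisors⟩ :
      nonZeroDivisors (MvPolynomial (Fin n) k))
  · have h : MvPolynomial.aeval
        (fun a => algebraMap (MvPolynomial (Fin n) k) (FractionRing _) (MvPolynomial.X a)) =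
        IsScalarTower.toAlgHom k (MvPolynomial (Fin n) k) (FractionRing (MvPolynomial (Fin n) k)) :=
      MvPolynomial.algHom_ext fun a => by rw [MvPolynomial.aeval_X, IsScalarTower.toAlgHom_apply]
    rw [h]
    exact IsFractionRing.injective _ _

end Representation

end Rouq

open Rouq in
/-- Fix a reduced expression for every element of `S_n`. The
family `S = {τ_{i_1,…} ⋯ τ_{i_r,ν} x_{1,ν}^{a_1} ⋯ x_{n,ν}^{a_n}}` generates
`H_n(Q)` as a `k`-module, and for `n ≥ 2` it is a basis (i.e. it is moreover
linearly independent) if and only if `Q` is hermitian. -/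
theorem statement0 (k : Type) [CommRing k] (I : Type) (n : ℕ) (hn : 1 ≤ n)
    (Q : I → I → MvPolynomial (Fin 2) k) (hQdiag : ∀ i, Q i i = 0)
    (red : Equiv.Perm (Fin n) → List ℕ)
    (hred : ∀ w, IsReducedWordFor n (red w) w) :
    (Submodule.span k
        (Set.range fun p : Equiv.Perm (Fin n) × (Fin n → ℕ) × (Fin n → I) =>
          mk Q (tauWord k (red p.1) p.2.2 *
            (List.ofFn fun b : Fin n => Xg k b p.2.2 ^ p.2.1 b).prod))
        = (Hgen Q).toSubmodule) ∧
    (2 ≤ n →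
      (LinearIndependent k
          (fun p : Equiv.Perm (Fin n) × (Fin n → ℕ) × (Fin n → I) =>
            mk Q (tauWord k (red p.1) p.2.2 *
              (List.ofFn fun b : Fin n => Xg k b p.2.2 ^ p.2.1 b).prod))
        ↔ Hermitian Q)) :=
  ⟨standardSpan_eq_Hgen hred, fun hn' =>
    ⟨hermitian_of_linearIndependent hn' hQdiag hred,
      fun hQ => linearIndependent_of_hermitian hQ hQdiag hred⟩⟩
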